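/- arXiv:1311.5726 — 2 statements merged into one kernel-verified Lean document; each statement's English description precedes it below -/
import Mathlib

section
/- For every integer l ≥ 4 there is a constant C_l > 0 such that for every prime p and every multiplicative subgroup Γ of F_p^* with |Γ| ≤ p^{2/3}, one has |E_l(Γ) − |Γ|^l| ≤ C_l · |Γ|^{(2l+3)/3}. -/
open Finset

/-- `(A ∘ A)(x)` = number of pairs `(a, a') ∈ A × A` with `a' - a = x`. -/
def convAA {p : ℕ} (A : Finset (ZMod p)) (x : ZMod p) : ℕ :=
  (A.filter fun a => a + x ∈ A).card

/-- The `k`-th energy `E_k(A) = Σ_x (A ∘ A)(x)^k`. -/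
def energyK {p : ℕ} [NeZero p] (k : ℕ) (A : Finset (ZMod p)) : ℕ :=
  ∑ x : ZMod p, (convAA A x) ^ k

open Polynomial

section Stepanov

variable {p : ℕ} [Fact p.Prime]

/-- A polynomial of degree less than `p` over `F_p` vanishing at `1` to an order at least its number
of nonzero coefficients is zero. -/
theorem eq_zero_of_card_support_le_of_pow_dvd (m : ℕ) (Q : (ZMod p)[X])
    (hm : Q.support.card ≤ m) (hdeg : ∀ k ∈ Q.support, k < p) (hdvd : (X - 1) ^ m ∣ Q) :
    Q = 0 := by
  induction m generalizing Q with
  | zero => simpa using hm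
  | succ m ih =>
    by_contra hQ
    obtain ⟨k₀, hk₀⟩ := Polynomial.nonempty_support_iff.2 hQ
    have hcoeff (k : ℕ) : (X * derivative Q - C (k₀ : ZMod p) * Q).coeff k =
        ((k : ZMod p) - k₀) * Q.coeff k := by
      rcases k with _ | k
      · simp
      · simp [coeff_X_mul, coeff_derivative]; ring
    have hsub : (X * derivative Q - C (k₀ : ZMod p) * Q).support ⊆ Q.support.erase k₀ := by
      intro k hk
      rw [mem_support_iff, hcoeff] at hk
      refine Finset.mem_erase.2 ⟨?_, mem_support_iff.2 (right_ne_zero_of_mul hk)⟩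
      rintro rfl
      simp at hk
    have hzero := ih (X * derivative Q - C (k₀ : ZMod p) * Q)
      (by
        have := Finset.card_le_card hsub
        rw [Finset.card_erase_of_mem hk₀] at this
        omega)
      (fun k hk => hdeg k (Finset.mem_of_mem_erase (hsub hk)))
      (by
        refine dvd_sub (Dvd.dvd.mul_left ?_ _) (Dvd.dvd.mul_left ((pow_dvd_pow _ m.le_succ).trans hdvd) _)
        obtain ⟨R, rfl⟩ := hdvd
        refine ⟨(m + 1 : (ZMod p)[X]) * R + (X - 1) * derivative R, ?_⟩
        simp [derivative_mul, derivative_pow]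
        ring)
    have hQ' : Q = monomial k₀ (Q.coeff k₀) := by
      ext k
      rw [coeff_monomial]
      split_ifs with h
      · rw [h]
      by_contra hk
      have h1 := hcoeff k
      rw [hzero, coeff_zero, eq_comm, mul_eq_zero, or_iff_left hk, sub_eq_zero,
        ZMod.natCast_eq_natCast_iff'] at h1
      rw [Nat.mod_eq_of_lt (hdeg k (mem_support_iff.2 hk)), Nat.mod_eq_of_lt (hdeg k₀ hk₀)] at h1
      exact h h1.symm
    have h1 : (X - 1 : (ZMod p)[X]) ∣ Q := (dvd_pow_self _ m.succ_ne_zero).trans hdvd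
    have h2 : Q.eval 1 = 0 := by
      obtain ⟨R, rfl⟩ := h1
      simp
    rw [hQ', eval_monomial] at h2
    exact mem_support_iff.1 hk₀ (by simpa using h2)

theorem eq_zero_of_sum_X_pow_mul_eq_zero {t : ℕ} (B : ℕ) (G : ℕ → (ZMod p)[X])
    (hG : ∀ b < B, X ^ t ∣ G b → G b = 0) (hsum : ∑ b ∈ Finset.range B, X ^ (t * b) * G b = 0) :
    ∀ b < B, G b = 0 := by
  induction B generalizing G with
  | zero => simp
  | succ B ih =>
    rw [Finset.sum_range_succ'] at hsum
    have hfac : ∑ b ∈ Finset.range B, X ^ (t * (b + 1)) * G (b + 1) =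
        X ^ t * ∑ b ∈ Finset.range B, X ^ (t * b) * G (b + 1) := by
      rw [Finset.mul_sum]
      refine Finset.sum_congr rfl fun b _ => ?_
      ring
    rw [hfac, mul_zero, pow_zero, one_mul] at hsum
    have h0 : G 0 = 0 := hG 0 B.succ_pos
      ((dvd_add_right (dvd_mul_right _ _)).1 (hsum ▸ dvd_zero _))
    rw [h0, add_zero, mul_eq_zero, or_iff_right (pow_ne_zero _ X_ne_zero)] at hsum
    intro b hb
    rcases b with _ | b
    · exact h0
    · exact ih (fun b => G (b + 1)) (fun b hb => hG (b + 1) (by omega)) hsum b (by omega)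

theorem eq_zero_of_X_pow_dvd_sum {t A B : ℕ} (hAB : A * B ≤ t) (htB : t * B ≤ p)
    (F : ℕ → (ZMod p)[X]) (hF : ∀ c, F c ∈ degreeLT (ZMod p) A)
    (hdvd : X ^ t ∣ ∑ c ∈ Finset.range B, (X + 1) ^ (t * c) * F c) :
    ∀ c < B, F c = 0 := by
  intro c₀ hc₀
  have hAt : A ≤ t := (Nat.le_mul_of_pos_right A (by omega)).trans hAB
  set H : ℕ → (ZMod p)[X] := fun c => (F c).comp (X - 1) with hH
  have hHdeg (c : ℕ) : H c ∈ degreeLT (ZMod p) A := by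
    have := hF c
    rw [mem_degreeLT] at this ⊢
    by_cases h0 : F c = 0
    · simp [hH, h0]
    · refine degree_le_natDegree.trans_lt ?_
      rw [← natDegree_lt_iff_degree_lt h0] at this
      have hd : (H c).natDegree ≤ (F c).natDegree := by
        have := natDegree_comp_le (p := F c) (q := (X - C 1 : (ZMod p)[X]))
        rwa [natDegree_X_sub_C, mul_one, C_1] at this
      exact_mod_cast hd.trans_lt this
  have hQ : (X - 1 : (ZMod p)[X]) ^ t ∣ ∑ c ∈ Finset.range B, X ^ (t * c) * H c := by
    obtain ⟨R, hR⟩ := hdvd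
    refine ⟨R.comp (X - 1), ?_⟩
    have := congrArg (compRingHom (X - 1 : (ZMod p)[X])) hR
    simpa [map_sum, hH] using this
  have hsupp : (∑ c ∈ Finset.range B, X ^ (t * c) * H c).support ⊆
      (Finset.range B ×ˢ Finset.range A).image fun ca => t * ca.1 + ca.2 := by
    intro k hk
    rw [mem_support_iff, finsetSum_coeff] at hk
    obtain ⟨c, hc, hck⟩ := Finset.exists_ne_zero_of_sum_ne_zero hk
    rw [coeff_X_pow_mul'] at hck
    split_ifs at hck with hle
    · refine Finset.mem_image.2 ⟨(c, k - t * c), Finset.mem_product.2 ⟨hc, ?_⟩, by simp; omega⟩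
      rw [Finset.mem_range]
      by_contra! hAk
      exact hck (coeff_eq_zero_of_degree_lt
        ((mem_degreeLT.1 (hHdeg c)).trans_le (by exact_mod_cast hAk)))
    · exact absurd rfl hck
  have hsum := eq_zero_of_card_support_le_of_pow_dvd t _
    ((Finset.card_le_card hsupp).trans (Finset.card_image_le.trans (by simpa [mul_comm] using hAB)))
    (by
      intro k hk
      obtain ⟨⟨c, a⟩, hca, rfl⟩ := Finset.mem_image.1 (hsupp hk)
      simp only [Finset.mem_product, Finset.mem_range] at hca
      dsimp only
      have : t * (c + 1) ≤ t * B := Nat.mul_le_mul_left t hca.1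
      rw [mul_add, mul_one] at this
      omega) hQ
  have hH0 := eq_zero_of_sum_X_pow_mul_eq_zero B H
    (fun c _ hdv => eq_zero_of_dvd_of_degree_lt hdv
      ((mem_degreeLT.1 (hHdeg c)).trans_le (by simpa using hAt))) hsum c₀ hc₀
  have := congrArg (fun q => q.comp (X + 1 : (ZMod p)[X])) hH0
  simpa [hH, comp_assoc] using this

/-- The monomials `X ^ a * (X ^ t) ^ b * ((X + 1) ^ t) ^ c` in a small box are linearly
independent. -/
theorem eq_zero_of_sum_X_pow_mul_X_add_one_pow_mul_eq_zero {t A B : ℕ} (hAB : A * B ≤ t)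
    (htB : t * B ≤ p) (F : ℕ → ℕ → (ZMod p)[X]) (hF : ∀ b c, F b c ∈ degreeLT (ZMod p) A)
    (hsum : ∑ b ∈ Finset.range B, ∑ c ∈ Finset.range B, F b c * (X ^ (t * b) * (X + 1) ^ (t * c)) = 0) :
    ∀ b < B, ∀ c < B, F b c = 0 := by
  have key := eq_zero_of_sum_X_pow_mul_eq_zero (t := t) B
    (fun b => ∑ c ∈ Finset.range B, (X + 1) ^ (t * c) * F b c)
    (fun b _ hdvd => Finset.sum_eq_zero fun c hc => by
      rw [eq_zero_of_X_pow_dvd_sum hAB htB (F b) (hF b) hdvd c (Finset.mem_range.1 hc), mul_zero])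
    (by
      rw [← hsum]
      refine Finset.sum_congr rfl fun b _ => ?_
      rw [Finset.mul_sum]
      exact Finset.sum_congr rfl fun c _ => by ring)
  exact fun b hb => eq_zero_of_X_pow_dvd_sum hAB htB (F b) (hF b) (by rw [key b hb]; exact dvd_zero _)

/-- The operator on coefficients `F` induced by applying `X (X + 1) d/dX` to
`F * X ^ m * (X + 1) ^ n`. -/
noncomputable def twistedDerivative (m n : ℕ) : Module.End (ZMod p) (ZMod p)[X] :=
  LinearMap.mulLeft (ZMod p) (X * (X + 1)) ∘ₗ derivative +
    LinearMap.mulLeft (ZMod p) (C (m : ZMod p) * (X + 1) + C (n : ZMod p) * X)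

theorem twistedDerivative_apply (m n : ℕ) (F : (ZMod p)[X]) :
    twistedDerivative m n F = X * (X + 1) * derivative F +
      (C (m : ZMod p) * (X + 1) + C (n : ZMod p) * X) * F := rfl

theorem twistedDerivative_zero_mul (m n : ℕ) (F : (ZMod p)[X]) :
    twistedDerivative 0 0 (F * (X ^ m * (X + 1) ^ n)) =
      twistedDerivative m n F * (X ^ m * (X + 1) ^ n) := by
  have h1 : X * derivative (X ^ m : (ZMod p)[X]) = C (m : ZMod p) * X ^ m := by
    rcases m with _ | m
    · simp
    · simp [derivative_pow]; ring
  have h2 : (X + 1) * derivative ((X + 1) ^ n : (ZMod p)[X]) = C (n : ZMod p) * (X + 1) ^ n := by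
    rcases n with _ | n
    · simp
    · simp [derivative_pow]; ring
  simp only [twistedDerivative_apply, derivative_mul]
  push_cast
  simp only [C_0, zero_mul, add_zero]
  linear_combination F * (X + 1) * (X + 1) ^ n * h1 + F * X * X ^ m * h2

theorem twistedDerivative_zero_pow_mul (m n k : ℕ) (F : (ZMod p)[X]) :
    (twistedDerivative 0 0 ^ k) (F * (X ^ m * (X + 1) ^ n)) =
      (twistedDerivative m n ^ k) F * (X ^ m * (X + 1) ^ n) := by
  induction k with
  | zero => simp
  | succ k ih => rw [pow_succ', pow_succ', Module.End.mul_apply, ih, twistedDerivative_zero_mul,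
      Module.End.mul_apply]

theorem twistedDerivative_mem_degreeLT (m n : ℕ) {d : ℕ} {F : (ZMod p)[X]}
    (hF : F ∈ degreeLT (ZMod p) d) : twistedDerivative m n F ∈ degreeLT (ZMod p) (d + 1) := by
  by_cases h0 : F = 0
  · simp [h0]
  rw [mem_degreeLT, ← natDegree_lt_iff_degree_lt h0] at hF
  rw [twistedDerivative_apply]
  have hbound (q : (ZMod p)[X]) (hq : q.natDegree < d + 1) : q ∈ degreeLT (ZMod p) (d + 1) :=
    mem_degreeLT.2 (degree_le_natDegree.trans_lt (by exact_mod_cast hq))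
  have hlin (a b : ZMod p) : (C a * (X + 1) + C b * X : (ZMod p)[X]).natDegree ≤ 1 := by
    compute_degree
  refine Submodule.add_mem _ ?_ (hbound _ ?_)
  · by_cases hd : F.natDegree = 0
    · rw [derivative_of_natDegree_zero hd]; simp
    · refine hbound _ (natDegree_mul_le.trans_lt ?_)
      have h1 : (X * (X + 1) : (ZMod p)[X]).natDegree ≤ 2 := by compute_degree
      have h2 := natDegree_derivative_lt hd
      omega
  · refine natDegree_mul_le.trans_lt ?_
    have := hlin m n
    omega

theorem twistedDerivative_pow_mem_degreeLT (m n k : ℕ) {d : ℕ} {F : (ZMod p)[X]}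
    (hF : F ∈ degreeLT (ZMod p) d) :
    (twistedDerivative m n ^ k) F ∈ degreeLT (ZMod p) (d + k) := by
  induction k with
  | zero => simpa using hF
  | succ k ih =>
    rw [pow_succ', Module.End.mul_apply]
    exact twistedDerivative_mem_degreeLT m n ih

theorem pow_dvd_of_eval_twistedDerivative_pow_eq_zero {x : ZMod p} (hx0 : x ≠ 0)
    (hx1 : x + 1 ≠ 0) (D : ℕ) (hD : D ≤ p) (f : (ZMod p)[X])
    (hf : ∀ k < D, ((twistedDerivative 0 0 ^ k) f).eval x = 0) : (X - C x) ^ D ∣ f := by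
  induction D generalizing f with
  | zero => simp
  | succ D ih =>
    have h1 : (X - C x) ^ D ∣ twistedDerivative 0 0 f := by
      refine ih (by omega) _ fun k hk => ?_
      have := hf (k + 1) (by omega)
      rwa [pow_succ, Module.End.mul_apply] at this
    have hder : (X - C x) ^ D ∣ derivative f := by
      have hcop : IsCoprime ((X - C x) ^ D) (X * (X + 1)) := by
        refine IsCoprime.pow_left (IsCoprime.mul_right ?_ ?_)
        · simpa using isCoprime_X_sub_C_of_isUnit_sub (a := x) (b := 0) (by simpa using hx0)
        · simpa using isCoprime_X_sub_C_of_isUnit_sub (a := x) (b := -1) (by simpa using hx1)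
      refine hcop.dvd_of_dvd_mul_left ?_
      simpa [twistedDerivative_apply] using h1
    rcases D with _ | D
    · simpa [dvd_iff_isRoot] using hf 0 (by simp)
    · obtain ⟨g, hg⟩ := ih (by omega) f fun k hk => hf k (by omega)
      have hp : ((D + 1 : ℕ) : ZMod p) ≠ 0 := by
        rw [Ne, ZMod.natCast_eq_zero_iff]
        exact Nat.not_dvd_of_pos_of_lt D.succ_pos (by omega)
      have hd : derivative f = (X - C x) ^ D * (C ((D + 1 : ℕ) : ZMod p) * g + (X - C x) * derivative g) := by
        rw [hg]
        simp [derivative_mul, derivative_pow]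
        ring
      rw [hd, pow_succ] at hder
      have h2 := (mul_dvd_mul_iff_left (pow_ne_zero _ (X_sub_C_ne_zero x))).1 hder
      rw [dvd_add_left (dvd_mul_right _ _), dvd_iff_isRoot] at h2
      have h3 : (X - C x) ∣ g := by
        rw [dvd_iff_isRoot]
        simpa [IsRoot, hp, -Nat.cast_add] using h2
      obtain ⟨q, rfl⟩ := h3
      exact ⟨q, by rw [hg]; ring⟩

/-- Siegel-type choice of auxiliary coefficients by counting linear conditions. -/
theorem exists_auxiliary_coefficients (t A B : ℕ) (T : Finset (ZMod p))
    (hcount : T.card * A * (2 * A) < B * B * A) :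
    ∃ F : ℕ → ℕ → (ZMod p)[X], (∀ b c, F b c ∈ degreeLT (ZMod p) A) ∧
      (∃ b < B, ∃ c < B, F b c ≠ 0) ∧
      ∀ β ∈ T, ∀ k < A, ∑ b ∈ Finset.range B, ∑ c ∈ Finset.range B,
        β ^ (b + c) • (twistedDerivative (t * b) (t * c) ^ k) (F b c) = 0 := by
  let φ (β : ZMod p) (k : ℕ) : (Fin B × Fin B → degreeLT (ZMod p) A) →ₗ[ZMod p] (ZMod p)[X] :=
    ∑ bc : Fin B × Fin B, β ^ (bc.1 + bc.2 : ℕ) •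
      ((twistedDerivative (t * bc.1) (t * bc.2) ^ k : Module.End (ZMod p) (ZMod p)[X]) ∘ₗ (degreeLT (ZMod p) A).subtype ∘ₗ
        (LinearMap.proj bc : (Fin B × Fin B → degreeLT (ZMod p) A) →ₗ[ZMod p] degreeLT (ZMod p) A))
  have hφ (β : ZMod p) (k : ℕ) (v) : φ β k v = ∑ bc : Fin B × Fin B, β ^ (bc.1 + bc.2 : ℕ) •
      (twistedDerivative (t * bc.1) (t * bc.2) ^ k) (v bc : (ZMod p)[X]) := by
    simp [φ, LinearMap.sum_apply]
  let Φ : (Fin B × Fin B → degreeLT (ZMod p) A) →ₗ[ZMod p] (T × Fin A × Fin (2 * A) → ZMod p) :=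
    LinearMap.pi fun i => lcoeff (ZMod p) i.2.2 ∘ₗ φ i.1 i.2.1
  have hrank : Module.finrank (ZMod p) (degreeLT (ZMod p) A) = A := by
    rw [(degreeLTEquiv (ZMod p) A).finrank_eq]; simp
  have : Module.Finite (ZMod p) (degreeLT (ZMod p) A) :=
    Module.Finite.equiv (degreeLTEquiv (ZMod p) A).symm
  have hker : LinearMap.ker Φ ≠ ⊥ := by
    refine LinearMap.ker_ne_bot_of_finrank_lt ?_
    rw [Module.finrank_pi_fintype, Module.finrank_pi_fintype]
    simpa [hrank, mul_assoc] using hcount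
  obtain ⟨v, hv, hv0⟩ := Submodule.exists_mem_ne_zero_of_ne_bot hker
  let F (b c : ℕ) : (ZMod p)[X] := if h : b < B ∧ c < B then (v (⟨b, h.1⟩, ⟨c, h.2⟩) : (ZMod p)[X]) else 0
  have hFv (bc : Fin B × Fin B) : F bc.1 bc.2 = v bc := by simp [F]
  refine ⟨F, fun b c => ?_, ?_, fun β hβ k hk => ?_⟩
  · simp only [F]
    split_ifs
    · exact SetLike.coe_mem _
    · exact zero_mem _
  · obtain ⟨bc, hbc⟩ := Function.ne_iff.1 hv0
    exact ⟨bc.1, bc.1.2, bc.2, bc.2.2, by rw [hFv]; simpa using hbc⟩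
  · have hsum : φ β k v = ∑ b ∈ Finset.range B, ∑ c ∈ Finset.range B,
        β ^ (b + c) • (twistedDerivative (t * b) (t * c) ^ k) (F b c) := by
      rw [hφ, Fintype.sum_prod_type, Finset.sum_range]
      refine Finset.sum_congr rfl fun b _ => ?_
      rw [Finset.sum_range]
      exact Finset.sum_congr rfl fun c _ => by rw [← hFv]
    rw [← hsum]
    have hdeg : φ β k v ∈ degreeLT (ZMod p) (A + k) := by
      rw [hφ]
      exact Submodule.sum_mem _ fun bc _ => Submodule.smul_mem _ _
        (twistedDerivative_pow_mem_degreeLT _ _ _ (SetLike.coe_mem _))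
    ext j
    rw [coeff_zero]
    by_cases hj : j < 2 * A
    · exact congrFun hv (⟨β, hβ⟩, ⟨k, hk⟩, ⟨j, hj⟩)
    · exact coeff_eq_zero_of_degree_lt ((mem_degreeLT.1 hdeg).trans_le
        (by exact_mod_cast (by omega : A + k ≤ j)))

/-- Stepanov's method for the equations `x ^ t = (x + 1) ^ t = β`, `β ∈ T`. -/
theorem card_mul_le_of_pow_eq_add_one_pow {t A B : ℕ} (hA : 0 < A) (hAB : A * B ≤ t)
    (htp : t ≤ p) (htB : t * B ≤ p) (T Z : Finset (ZMod p)) (hT : 2 * T.card * A < B * B)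
    (hZ : ∀ x ∈ Z, x ≠ 0 ∧ x + 1 ≠ 0 ∧ ∃ β ∈ T, x ^ t = β ∧ (x + 1) ^ t = β) :
    Z.card * A ≤ 2 * t * B := by
  obtain ⟨F, hF, ⟨b₀, hb₀, c₀, hc₀, hne⟩, hvan⟩ := exists_auxiliary_coefficients t A B T (by
    have := Nat.mul_lt_mul_of_pos_right hT hA
    linarith)
  have hAt : A ≤ t := (Nat.le_mul_of_pos_right A (by omega)).trans hAB
  set Ψ : (ZMod p)[X] := ∑ b ∈ Finset.range B, ∑ c ∈ Finset.range B, F b c * (X ^ (t * b) * (X + 1) ^ (t * c))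
    with hΨ
  have hΨ0 : Ψ ≠ 0 := fun h =>
    hne (eq_zero_of_sum_X_pow_mul_X_add_one_pow_mul_eq_zero hAB htB F hF h b₀ hb₀ c₀ hc₀)
  have hdeg : Ψ.natDegree ≤ 2 * t * B := by
    refine natDegree_sum_le_of_forall_le _ _ fun b hb => natDegree_sum_le_of_forall_le _ _ fun c hc => ?_
    rw [Finset.mem_range] at hb hc
    have h1 : (F b c).natDegree ≤ A := by
      refine natDegree_le_of_degree_le (mem_degreeLT.1 (hF b c)).le
    have h2 : (X ^ (t * b) * (X + 1) ^ (t * c) : (ZMod p)[X]).natDegree ≤ t * b + t * c := by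
      compute_degree
    have h3 : t * (b + 1) ≤ t * B := Nat.mul_le_mul_left t hb
    have h4 : t * (c + 1) ≤ t * B := Nat.mul_le_mul_left t hc
    refine natDegree_mul_le.trans ?_
    nlinarith
  have hdvd : ∏ x ∈ Z, (X - C x) ^ A ∣ Ψ := by
    refine Finset.prod_dvd_of_coprime (fun x _ y _ hxy =>
      (isCoprime_X_sub_C_of_isUnit_sub (by simpa [sub_eq_zero] using hxy)).pow) fun x hx => ?_
    obtain ⟨hx0, hx1, β, hβ, hxβ, hxβ'⟩ := hZ x hx
    refine pow_dvd_of_eval_twistedDerivative_pow_eq_zero hx0 hx1 A (hAt.trans htp) Ψ fun k hk => ?_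
    have := congrArg (fun q => q.eval x) (hvan β hβ k hk)
    simp only [eval_finsetSum, eval_smul, eval_zero, smul_eq_mul] at this
    rw [← this]
    simp only [hΨ, map_sum, twistedDerivative_zero_pow_mul]
    simp only [eval_finsetSum, eval_mul, eval_pow,
      eval_add, eval_X, eval_one, pow_mul, hxβ, hxβ']
    exact Finset.sum_congr rfl fun b _ => Finset.sum_congr rfl fun c _ => by ring
  refine le_trans (le_of_eq ?_) ((natDegree_le_of_dvd hdvd hΨ0).trans hdeg)
  rw [natDegree_prod_of_monic _ _ fun x _ => (monic_X_sub_C x).pow A]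
  simp

end Stepanov

theorem exists_auxiliary_parameters {n t : ℕ} (hn : 0 < n) (hnt : n ≤ t ^ 2) (ht : 4096 < t) :
    ∃ A B : ℕ, 0 < A ∧ B ^ 3 ≤ n ∧ 2 * n * A < t * B ^ 2 ∧ t * B ^ 2 ≤ 4 * n * A ∧
      n ≤ 8 * B ^ 3 := by
  set B := Nat.findGreatest (fun B => B ^ 3 ≤ n) n with hB
  have hB3 : B ^ 3 ≤ n := Nat.findGreatest_spec (P := fun B => B ^ 3 ≤ n) (m := 1) hn (by rw [one_pow]; exact hn)
  have hB1 : 1 ≤ B := Nat.le_findGreatest hn (by rw [one_pow]; exact hn)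
  have hlt : n < (B + 1) ^ 3 := by
    by_contra! h
    have h1 : B + 1 ≤ n := (Nat.le_self_pow three_ne_zero _).trans h
    exact absurd (Nat.le_findGreatest (P := fun B => B ^ 3 ≤ n) h1 h) (by omega)
  have h8 : n ≤ 8 * B ^ 3 := by
    have : (B + 1) ^ 3 ≤ (2 * B) ^ 3 := Nat.pow_le_pow_left (by omega) 3
    nlinarith
  have hBt : 16 * B < t := by
    by_contra! h
    have h1 : t ^ 3 ≤ (16 * B) ^ 3 := Nat.pow_le_pow_left h 3
    nlinarith [pow_pos (by omega : 0 < t) 2]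
  have h2n : 2 * n < t * B ^ 2 := by
    have : 16 * B * B ^ 2 < t * B ^ 2 := Nat.mul_lt_mul_of_pos_right hBt (by positivity)
    nlinarith
  have hdm := Nat.div_add_mod (t * B ^ 2 - 1) (2 * n)
  have hmod := Nat.mod_lt (t * B ^ 2 - 1) (by omega : 0 < 2 * n)
  have hA : 0 < (t * B ^ 2 - 1) / (2 * n) := Nat.div_pos (by omega) (by omega)
  refine ⟨(t * B ^ 2 - 1) / (2 * n), B, hA, hB3, by omega, ?_, h8⟩
  have := Nat.mul_le_mul_left (2 * n) hA
  rw [show 4 * n * ((t * B ^ 2 - 1) / (2 * n)) = 2 * (2 * n * ((t * B ^ 2 - 1) / (2 * n))) by ring]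
  omega

section Subgroup

variable {p : ℕ} [Fact p.Prime] {Γ : Finset (ZMod p)}

theorem pow_card_eq_one_of_mul_mem (h0 : (0 : ZMod p) ∉ Γ)
    (hmul : ∀ x ∈ Γ, ∀ y ∈ Γ, x * y ∈ Γ) {x : ZMod p} (hx : x ∈ Γ) : x ^ Γ.card = 1 := by
  have hx0 : x ≠ 0 := ne_of_mem_of_not_mem hx h0
  have himage : Γ.image (x * ·) = Γ := by
    refine Finset.eq_of_subset_of_card_le (Finset.image_subset_iff.2 fun y hy => hmul x hx y hy) ?_
    rw [Finset.card_image_of_injective _ (mul_right_injective₀ hx0)]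
  have hprod : ∏ y ∈ Γ, y ≠ 0 :=
    Finset.prod_ne_zero_iff.2 fun y hy => ne_of_mem_of_not_mem hy h0
  have h : ∏ y ∈ Γ.image (x * ·), y = x ^ Γ.card * ∏ y ∈ Γ, y := by
    rw [Finset.prod_image (mul_right_injective₀ hx0).injOn, Finset.prod_mul_distrib,
      Finset.prod_const]
  rw [himage] at h
  exact mul_right_cancel₀ hprod (by rw [← h, one_mul])

theorem convAA_le_convAA_mul (h0 : (0 : ZMod p) ∉ Γ)
    (hmul : ∀ x ∈ Γ, ∀ y ∈ Γ, x * y ∈ Γ) {g : ZMod p} (hg : g ∈ Γ) (d : ZMod p) :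
    convAA Γ d ≤ convAA Γ (d * g) := by
  refine Finset.card_le_card_of_injOn (· * g) (fun a ha => ?_)
    (mul_left_injective₀ (ne_of_mem_of_not_mem hg h0)).injOn
  simp only [Finset.coe_filter, Set.mem_ofPred_eq] at ha ⊢
  exact ⟨hmul a ha.1 g hg, by rw [← add_mul]; exact hmul _ ha.2 g hg⟩

/-- The nonzero differences having at least `τ` representations. -/
def popularDifferences (Γ : Finset (ZMod p)) (τ : ℕ) : Finset (ZMod p) :=
  univ.filter fun d => d ≠ 0 ∧ τ ≤ convAA Γ d

theorem mem_popularDifferences {τ : ℕ} {d : ZMod p} :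
    d ∈ popularDifferences Γ τ ↔ d ≠ 0 ∧ τ ≤ convAA Γ d := by
  simp [popularDifferences]

theorem card_popularDifferences_mul_le {N τ : ℕ}
    (hN : ∀ a ∈ Γ, ((popularDifferences Γ τ).filter fun d => a + d ∈ Γ).card ≤ N) :
    (popularDifferences Γ τ).card * τ ≤ Γ.card * N := by
  calc (popularDifferences Γ τ).card * τ ≤ ∑ d ∈ popularDifferences Γ τ, convAA Γ d := by
        rw [← smul_eq_mul]
        exact Finset.card_nsmul_le_sum _ _ _ fun d hd => (mem_popularDifferences.1 hd).2
    _ = ∑ a ∈ Γ, ((popularDifferences Γ τ).filter fun d => a + d ∈ Γ).card := by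
        simp only [convAA, Finset.card_filter]
        exact Finset.sum_comm
    _ ≤ Γ.card * N := by
        rw [← smul_eq_mul]
        exact Finset.sum_le_card_nsmul _ _ _ hN

theorem mul_mem_popularDifferences (h0 : (0 : ZMod p) ∉ Γ)
    (hmul : ∀ x ∈ Γ, ∀ y ∈ Γ, x * y ∈ Γ) {τ : ℕ} {d g : ZMod p}
    (hd : d ∈ popularDifferences Γ τ) (hg : g ∈ Γ) : d * g ∈ popularDifferences Γ τ := by
  rw [mem_popularDifferences] at hd ⊢
  exact ⟨mul_ne_zero hd.1 (ne_of_mem_of_not_mem hg h0),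
    hd.2.trans (convAA_le_convAA_mul h0 hmul hg d)⟩

theorem card_popularDifferences_mul_cube_le (h0 : (0 : ZMod p) ∉ Γ) (h1 : (1 : ZMod p) ∈ Γ)
    (hmul : ∀ x ∈ Γ, ∀ y ∈ Γ, x * y ∈ Γ) (hcard : Γ.card ^ 3 ≤ p ^ 2) {τ : ℕ} (hτ : 0 < τ) :
    (popularDifferences Γ τ).card * τ ^ 3 ≤ 4096 * Γ.card ^ 3 := by
  set t := Γ.card with ht
  set L := popularDifferences Γ τ with hL
  set n := L.card with hn
  have htpos : 0 < t := Finset.card_pos.2 ⟨1, h1⟩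
  have hp : 0 < p := (Fact.out : p.Prime).pos
  rcases L.eq_empty_or_nonempty with hemp | ⟨d₀, hd₀⟩
  · rw [hn, hemp]; simp
  have hnpos : 0 < n := Finset.card_pos.2 ⟨d₀, hd₀⟩
  have hτt : τ ≤ t := (mem_popularDifferences.1 hd₀).2.trans (Finset.card_filter_le _ _)
  have hnτ : n * τ ≤ t * t := by
    refine card_popularDifferences_mul_le fun a _ => ?_
    refine Finset.card_le_card_of_injOn (a + ·) (fun d hd => ?_) (add_right_injective a).injOn
    exact (Finset.mem_filter.1 hd).2
  rcases le_or_gt t 4096 with hsmall | hlarge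
  · calc n * τ ^ 3 = (n * τ) * (τ * τ) := by ring
      _ ≤ (t * t) * (t * t) := Nat.mul_le_mul hnτ (Nat.mul_le_mul hτt hτt)
      _ = t * t ^ 3 := by ring
      _ ≤ 4096 * t ^ 3 := Nat.mul_le_mul_right _ hsmall
  have hnt : n ≤ t ^ 2 := by nlinarith
  obtain ⟨A, B, hA, hBn, hAlt, hAge, hnB⟩ := exists_auxiliary_parameters hnpos hnt hlarge
  have hnp : n ≤ p := by simpa [ZMod.card] using Finset.card_le_univ L
  have htB : t * B ≤ p := by
    refine le_of_pow_le_pow_left₀ three_ne_zero hp.le ?_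
    calc (t * B) ^ 3 = t ^ 3 * B ^ 3 := by ring
      _ ≤ p ^ 2 * p := Nat.mul_le_mul hcard (hBn.trans hnp)
      _ = p ^ 3 := by ring
  have htp : t ≤ p := by
    refine (Finset.card_le_univ Γ).trans ?_
    simp [ZMod.card]
  have hAB : A * B ≤ t := by
    refine Nat.le_of_mul_le_mul_left ?_ hnpos
    nlinarith
  set T := L.image fun d => (d ^ t)⁻¹ with hT
  have hTcard : t * T.card ≤ n := by
    refine Finset.mul_card_image_le_card _ _ fun β hβ => ?_
    obtain ⟨d, hd, rfl⟩ := Finset.mem_image.1 hβ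
    refine Finset.card_le_card_of_injOn (d * ·) (fun g hg => ?_)
      (mul_right_injective₀ (mem_popularDifferences.1 hd).1).injOn
    simp only [Finset.coe_filter, Set.mem_ofPred_eq]
    exact ⟨mul_mem_popularDifferences h0 hmul hd hg, by
      rw [mul_pow, ht, pow_card_eq_one_of_mul_mem h0 hmul hg, mul_one]⟩
  set Z : Finset (ZMod p) := univ.filter fun x =>
    x ≠ 0 ∧ x + 1 ≠ 0 ∧ ∃ β ∈ T, x ^ t = β ∧ (x + 1) ^ t = β with hZ
  have hnZ : n * τ ≤ t * Z.card := by
    refine card_popularDifferences_mul_le fun a ha => ?_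
    have ha0 : a ≠ 0 := ne_of_mem_of_not_mem ha h0
    refine Finset.card_le_card_of_injOn (a / ·) (fun d hd => ?_) ?_
    · simp only [Finset.coe_filter, Set.mem_ofPred_eq] at hd
      have hd0 := (mem_popularDifferences.1 hd.1).1
      have hadd : a / d + 1 = (a + d) / d := by field_simp
      simp only [hZ, Finset.coe_filter, Set.mem_ofPred_eq, Finset.mem_univ, true_and, hadd, div_pow]
      refine ⟨div_ne_zero ha0 hd0, div_ne_zero (ne_of_mem_of_not_mem hd.2 h0) hd0, (d ^ t)⁻¹,
        Finset.mem_image_of_mem _ hd.1, ?_, ?_⟩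
      · rw [ht, pow_card_eq_one_of_mul_mem h0 hmul ha, one_div]
      · rw [ht, pow_card_eq_one_of_mul_mem h0 hmul hd.2, one_div]
    · intro d _ d' _ h
      simpa [div_eq_mul_inv, ha0] using h
  have hZA : Z.card * A ≤ 2 * t * B := by
    refine card_mul_le_of_pow_eq_add_one_pow hA hAB htp htB T Z ?_ fun x hx =>
      (Finset.mem_filter.1 hx).2
    refine lt_of_mul_lt_mul_left (a := t) ?_ htpos.le
    nlinarith
  have hBpos : 0 < B := by
    rcases Nat.eq_zero_or_pos B with rfl | h
    · omega
    · exact h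
  have hτB : τ * B ≤ 8 * t := by
    refine le_of_mul_le_mul_left (a := n * t * B) ?_ (by positivity)
    calc n * t * B * (τ * B) = n * τ * (t * B ^ 2) := by ring
      _ ≤ (t * Z.card) * (4 * n * A) := Nat.mul_le_mul hnZ hAge
      _ = 4 * n * t * (Z.card * A) := by ring
      _ ≤ 4 * n * t * (2 * t * B) := Nat.mul_le_mul_left _ hZA
      _ = n * t * B * (8 * t) := by ring
  calc n * τ ^ 3 ≤ 8 * B ^ 3 * τ ^ 3 := Nat.mul_le_mul_right _ hnB
    _ = 8 * (τ * B) ^ 3 := by ring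
    _ ≤ 8 * (8 * t) ^ 3 := Nat.mul_le_mul_left _ (Nat.pow_le_pow_left hτB 3)
    _ = 4096 * t ^ 3 := by ring

theorem convAA_cube_le (h0 : (0 : ZMod p) ∉ Γ) (h1 : (1 : ZMod p) ∈ Γ)
    (hmul : ∀ x ∈ Γ, ∀ y ∈ Γ, x * y ∈ Γ) (hcard : Γ.card ^ 3 ≤ p ^ 2) {d : ZMod p} (hd : d ≠ 0) :
    convAA Γ d ^ 3 ≤ 4096 * Γ.card ^ 2 := by
  rcases Nat.eq_zero_or_pos (convAA Γ d) with h | h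
  · simp [h]
  have hmem : d ∈ popularDifferences Γ (convAA Γ d) := mem_popularDifferences.2 ⟨hd, le_rfl⟩
  have hle : Γ.card ≤ (popularDifferences Γ (convAA Γ d)).card :=
    Finset.card_le_card_of_injOn (d * ·)
      (fun g hg => mul_mem_popularDifferences h0 hmul hmem hg) (mul_right_injective₀ hd).injOn
  have := card_popularDifferences_mul_cube_le h0 h1 hmul hcard h
  refine le_of_mul_le_mul_left (a := Γ.card) ?_ (Finset.card_pos.2 ⟨1, h1⟩)
  calc Γ.card * convAA Γ d ^ 3 ≤ _ := Nat.mul_le_mul_right _ hle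
    _ ≤ _ := this
    _ = _ := by ring

theorem add_one_pow_le_pow_add_mul_pow (k r : ℕ) :
    (r + 1) ^ (k + 1) ≤ r ^ (k + 1) + (k + 1) * (r + 1) ^ k := by
  induction k with
  | zero => simp
  | succ k ih =>
    have h := Nat.mul_le_mul_right (r + 1) ih
    have h2 : r ^ (k + 1) ≤ (r + 1) ^ (k + 1) := Nat.pow_le_pow_left r.le_succ _
    calc (r + 1) ^ (k + 1 + 1) = (r + 1) ^ (k + 1) * (r + 1) := pow_succ _ _
      _ ≤ (r ^ (k + 1) + (k + 1) * (r + 1) ^ k) * (r + 1) := h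
      _ = r ^ (k + 1 + 1) + r ^ (k + 1) + (k + 1) * (r + 1) ^ (k + 1) := by ring
      _ ≤ r ^ (k + 1 + 1) + (r + 1) ^ (k + 1) + (k + 1) * (r + 1) ^ (k + 1) := by gcongr
      _ = r ^ (k + 1 + 1) + (k + 1 + 1) * (r + 1) ^ (k + 1) := by ring

theorem pow_le_mul_sum_pow (k r : ℕ) :
    r ^ (k + 1) ≤ (k + 1) * ∑ τ ∈ Finset.range r, (τ + 1) ^ k := by
  induction r with
  | zero => simp
  | succ r ih =>
    rw [Finset.sum_range_succ, mul_add]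
    have h := add_one_pow_le_pow_add_mul_pow k r
    omega

theorem sum_convAA_pow_le (h0 : (0 : ZMod p) ∉ Γ) (h1 : (1 : ZMod p) ∈ Γ)
    (hmul : ∀ x ∈ Γ, ∀ y ∈ Γ, x * y ∈ Γ) (hcard : Γ.card ^ 3 ≤ p ^ 2) (m M : ℕ)
    (hM : ∀ d ≠ 0, convAA Γ d ≤ M) :
    ∑ d ∈ univ.erase (0 : ZMod p), convAA Γ d ^ (m + 4) ≤
      (m + 4) * (4096 * Γ.card ^ 3 * M ^ (m + 1)) := by
  calc ∑ d ∈ univ.erase (0 : ZMod p), convAA Γ d ^ (m + 4)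
      ≤ ∑ d ∈ univ.erase (0 : ZMod p), (m + 4) * ∑ τ ∈ Finset.range M,
          if τ + 1 ≤ convAA Γ d then (τ + 1) ^ (m + 3) else 0 := by
        refine Finset.sum_le_sum fun d hd => (pow_le_mul_sum_pow (m + 3) _).trans_eq ?_
        congr 1
        rw [← Finset.sum_filter]
        refine Finset.sum_congr ?_ fun _ _ => rfl
        ext τ
        have := hM d (Finset.ne_of_mem_erase hd)
        simp only [Finset.mem_range, Finset.mem_filter]
        omega
    _ = (m + 4) * ∑ τ ∈ Finset.range M,
          (popularDifferences Γ (τ + 1)).card * (τ + 1) ^ (m + 3) := by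
        rw [← Finset.mul_sum, Finset.sum_comm]
        congr 1
        refine Finset.sum_congr rfl fun τ _ => ?_
        rw [← Finset.sum_filter, Finset.sum_const, smul_eq_mul]
        congr 2
        ext d
        simp [mem_popularDifferences]
    _ ≤ (m + 4) * ∑ τ ∈ Finset.range M, 4096 * Γ.card ^ 3 * M ^ m := by
        refine Nat.mul_le_mul_left _ (Finset.sum_le_sum fun τ hτ => ?_)
        rw [show m + 3 = 3 + m by ring, pow_add, ← mul_assoc]
        exact Nat.mul_le_mul
          (card_popularDifferences_mul_cube_le h0 h1 hmul hcard τ.succ_pos)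
          (Nat.pow_le_pow_left (Finset.mem_range.1 hτ) m)
    _ = (m + 4) * (4096 * Γ.card ^ 3 * M ^ (m + 1)) := by
        rw [Finset.sum_const, Finset.card_range, smul_eq_mul]
        ring

theorem energyK_eq_card_pow_add_sum (k : ℕ) (Γ : Finset (ZMod p)) :
    energyK k Γ = Γ.card ^ k + ∑ d ∈ univ.erase (0 : ZMod p), convAA Γ d ^ k := by
  rw [energyK, ← Finset.add_sum_erase _ _ (Finset.mem_univ (0 : ZMod p))]
  simp [convAA]

end Subgroup

/-- For every integer `l ≥ 4` there is a constant `C_l > 0` such that for every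
prime `p` and every multiplicative subgroup `Γ ⊆ F_p^*` with `|Γ| ≤ p^{2/3}`, one has
`|E_l(Γ) − |Γ|^l| ≤ C_l · |Γ|^{(2l+3)/3}`. -/
theorem stmt6 :
    ∀ l : ℕ, 4 ≤ l →
      ∃ C : ℝ, 0 < C ∧
        ∀ (p : ℕ) [Fact p.Prime], ∀ Γ : Finset (ZMod p),
          (0 : ZMod p) ∉ Γ → (1 : ZMod p) ∈ Γ →
          (∀ x ∈ Γ, ∀ y ∈ Γ, x * y ∈ Γ) → (∀ x ∈ Γ, x⁻¹ ∈ Γ) →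
          (Γ.card : ℝ) ≤ (p : ℝ) ^ ((2 : ℝ) / 3) →
          |(energyK l Γ : ℝ) - (Γ.card : ℝ) ^ l| ≤
            C * (Γ.card : ℝ) ^ ((2 * (l : ℝ) + 3) / 3) := by
  intro l hl
  obtain ⟨m, rfl⟩ := Nat.exists_eq_add_of_le' hl
  refine ⟨(m + 4) * (4096 * 16 ^ (m + 1)), by positivity, ?_⟩
  intro p _ Γ h0 h1 hmul _ hle
  set t : ℝ := (Γ.card : ℝ) with ht
  have htpos : 0 < t := Nat.cast_pos.2 (Finset.card_pos.2 ⟨1, h1⟩)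
  have hcard : Γ.card ^ 3 ≤ p ^ 2 := by
    have h := pow_le_pow_left₀ htpos.le hle 3
    rw [← Real.rpow_natCast, ← Real.rpow_natCast, ← Real.rpow_mul p.cast_nonneg] at h
    norm_num at h
    rw [ht] at h
    exact_mod_cast h
  set M : ℕ := univ.sup fun d : ZMod p => if d = 0 then 0 else convAA Γ d with hMdef
  have hM (d : ZMod p) (hd : d ≠ 0) : convAA Γ d ≤ M := by
    have := Finset.le_sup (f := fun d : ZMod p => if d = 0 then 0 else convAA Γ d) (Finset.mem_univ d)
    simpa [hd] using this
  have hM3 : M ^ 3 ≤ 4096 * Γ.card ^ 2 := by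
    obtain ⟨d, _, hd⟩ := Finset.exists_mem_eq_sup univ Finset.univ_nonempty
      fun d : ZMod p => if d = 0 then 0 else convAA Γ d
    rw [hMdef, hd]
    split_ifs with h
    · simp
    · exact convAA_cube_le h0 h1 hmul hcard h
  have hMt : (M : ℝ) ≤ 16 * t ^ ((2 : ℝ) / 3) := by
    refine le_of_pow_le_pow_left₀ three_ne_zero (by positivity) ?_
    rw [mul_pow, ← Real.rpow_natCast (t ^ _), ← Real.rpow_mul htpos.le]
    norm_num
    rw [ht]
    exact_mod_cast hM3
  have hsum := sum_convAA_pow_le h0 h1 hmul hcard m M hM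
  rw [energyK_eq_card_pow_add_sum, Nat.cast_add, Nat.cast_pow, add_sub_cancel_left,
    abs_of_nonneg (Nat.cast_nonneg _)]
  calc _ ≤ (((m + 4) * (4096 * Γ.card ^ 3 * M ^ (m + 1)) : ℕ) : ℝ) := Nat.cast_le.2 hsum
    _ = (m + 4) * (4096 * t ^ 3 * (M : ℝ) ^ (m + 1)) := by push_cast; ring
    _ ≤ (m + 4) * (4096 * t ^ 3 * (16 * t ^ ((2 : ℝ) / 3)) ^ (m + 1)) := by gcongr
    _ = (m + 4) * (4096 * 16 ^ (m + 1)) * (t ^ (3 : ℝ) * t ^ ((2 : ℝ) / 3 * ((m + 1 : ℕ) : ℝ))) := by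
      rw [mul_pow, Real.rpow_mul htpos.le, Real.rpow_natCast, ← Real.rpow_natCast t 3]
      push_cast
      ring
    _ = _ := by
      rw [← Real.rpow_add htpos]
      congr 2
      push_cast
      ring
end

section
/- For every integer d ≥ 2 there is a constant C_d > 0 such that for every prime p and every multiplicative subgroup Γ of F_p^* with |Γ| < p^{1/2}, one has T_d(Γ) ≤ C_d · |Γ|^{2d − 2 + 2^{1−d}}. -/
open Finset

/-- `T_k(A) = #{(a₁,…,a_k,a'₁,…,a'_k) ∈ A^{2k} : a₁ + ⋯ + a_k = a'₁ + ⋯ + a'_k}`. -/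
def Tk {p : ℕ} [NeZero p] (k : ℕ) (A : Finset (ZMod p)) : ℕ :=
  Fintype.card {fg : (Fin k → ZMod p) × (Fin k → ZMod p) //
    (∀ i, fg.1 i ∈ A) ∧ (∀ i, fg.2 i ∈ A) ∧ ∑ i, fg.1 i = ∑ i, fg.2 i}

open Polynomial in
theorem Polynomial.lt_card_support_of_X_sub_one_pow_dvd {K : Type*} [Field K] {p : ℕ} [CharP K p]
    (n : ℕ) (f : K[X]) (hf : f ≠ 0) (hdeg : f.natDegree < p) (hdvd : (X - 1) ^ n ∣ f) :
    n < #f.support := by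
  induction n generalizing f with
  | zero => exact Finset.card_pos.2 (Polynomial.support_nonempty.2 hf)
  | succ n ih =>
    have hlt : ∀ i ∈ f.support, i < p := fun i hi => (le_natDegree_of_mem_supp i hi).trans_lt hdeg
    obtain ⟨m, hm⟩ := Polynomial.support_nonempty.2 hf
    set g : K[X] := X * derivative f - C (m : K) * f with hg
    have hcoeff : ∀ i, g.coeff i = ((i : K) - m) * f.coeff i := by
      intro i
      rcases i with _ | i
      · simp [hg]
      · simp [hg, coeff_X_mul, coeff_derivative]; ring
    have hsub : g.support ⊆ f.support.erase m := by
      intro i hi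
      rw [mem_support_iff, hcoeff] at hi
      rw [Finset.mem_erase, mem_support_iff]
      refine ⟨?_, right_ne_zero_of_mul hi⟩
      rintro rfl
      simp at hi
    have hgd : (X - 1) ^ n ∣ g := by
      obtain ⟨q, rfl⟩ := hdvd
      refine dvd_sub (Dvd.dvd.mul_left ?_ _) (Dvd.dvd.mul_left ?_ _)
      · rw [derivative_mul]
        refine dvd_add (Dvd.dvd.mul_right ?_ _) (Dvd.dvd.mul_right (pow_dvd_pow _ n.le_succ) _)
        rw [derivative_pow]
        exact Dvd.dvd.mul_right (Dvd.dvd.mul_left (by simp) _) _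
      · exact Dvd.dvd.mul_right (pow_dvd_pow _ n.le_succ) _
    have hg0 : g ≠ 0 := by
      intro h0
      have honly : ∀ i ∈ f.support, i = m := by
        intro i hi
        have h1 := hcoeff i
        rw [h0, coeff_zero, eq_comm, mul_eq_zero, sub_eq_zero] at h1
        rcases h1 with h1 | h1
        · exact CharP.natCast_injOn_Iio K p (hlt i hi) (hlt m hm) h1
        · exact absurd h1 (mem_support_iff.1 hi)
      have hs : f.support = {m} := Finset.eq_singleton_iff_unique_mem.2 ⟨hm, honly⟩
      have h1 : f.eval 1 = 0 := by
        obtain ⟨q, rfl⟩ := hdvd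
        simp
      rw [eval_eq_sum, Polynomial.sum, hs] at h1
      simp at h1
      exact mem_support_iff.1 hm h1
    have hgdeg : g.natDegree < p := by
      refine hlt _ (Finset.mem_of_mem_erase (hsub (natDegree_mem_support_of_nonzero hg0)))
    have h1 := ih g hg0 hgdeg hgd
    have h2 := Finset.card_le_card hsub
    rw [Finset.card_erase_of_mem hm] at h2
    omega

open Polynomial in
theorem Polynomial.eq_zero_of_sum_mul_pow_eq_zero {K : Type*} [Field K] {q : K[X]} (hq : q ≠ 0)
    (B : ℕ) (P : Fin B → K[X]) (hP : ∀ c, q ∣ P c → P c = 0) (h : ∑ c, P c * q ^ (c : ℕ) = 0)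
    (c : Fin B) : P c = 0 := by
  induction B with
  | zero => exact c.elim0
  | succ B ih =>
    rw [Fin.sum_univ_succ] at h
    have h1 : ∑ i : Fin B, P i.succ * q ^ ((i.succ : Fin (B + 1)) : ℕ)
        = q * ∑ i : Fin B, P i.succ * q ^ (i : ℕ) := by
      rw [Finset.mul_sum]
      refine Finset.sum_congr rfl fun i _ => ?_
      rw [Fin.val_succ, pow_succ]; ring
    rw [h1] at h
    simp only [Fin.val_zero, pow_zero, mul_one] at h
    have h0 : P 0 = 0 := hP 0 ⟨-∑ i : Fin B, P i.succ * q ^ (i : ℕ), by linear_combination h⟩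
    rw [h0, zero_add] at h
    have h2 := (mul_eq_zero.1 h).resolve_left hq
    induction c using Fin.cases with
    | zero => exact h0
    | succ i => exact ih (fun i => P i.succ) (fun i => hP i.succ) h2 i

/-- The polynomial `∑ λ_{abc} X^a X^{tb} (1 - X)^{tc}`. -/
noncomputable def stepanovPoly {K : Type*} [Field K] (t A B : ℕ) (l : Fin A × Fin B × Fin B → K) :
    Polynomial K :=
  ∑ i, Polynomial.C (l i) * (Polynomial.X ^ (i.1 : ℕ) *
    (Polynomial.X ^ (t * i.2.1) * (1 - Polynomial.X) ^ (t * i.2.2)))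

open Polynomial in
theorem stepanovPoly_ne_zero {K : Type*} [Field K] {p : ℕ} [CharP K p] {t A B : ℕ}
    (hAt : A ≤ t) (hAB : A * B ≤ t) (htB : t * B ≤ p)
    {l : Fin A × Fin B × Fin B → K} (hl : l ≠ 0) : stepanovPoly t A B l ≠ 0 := by
  intro h0
  apply hl
  set P : Fin B → K[X] := fun c => ∑ i : Fin A × Fin B,
    monomial ((i.1 : ℕ) + t * i.2) (l (i.1, i.2, c)) with hPdef
  have hinj : ∀ i j : Fin A × Fin B, (i.1 : ℕ) + t * i.2 = j.1 + t * j.2 → i = j := by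
    rintro ⟨a, b⟩ ⟨a', b'⟩ h
    simp only at h
    have ht : 0 < t := by have := a.2; omega
    have ha : (a : ℕ) = a' := by
      have := congrArg (· % t) h
      simpa [Nat.add_mul_mod_self_left, Nat.mod_eq_of_lt (a.2.trans_le hAt),
        Nat.mod_eq_of_lt (a'.2.trans_le hAt)] using this
    have hb : (b : ℕ) = b' := by
      rw [ha] at h
      exact Nat.eq_of_mul_eq_mul_left ht (by omega)
    exact Prod.ext (Fin.ext ha) (Fin.ext hb)
  have hcoeff : ∀ c (i : Fin A × Fin B), (P c).coeff ((i.1 : ℕ) + t * i.2) = l (i.1, i.2, c) := by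
    intro c i
    simp only [hPdef, finsetSum_coeff, coeff_monomial]
    rw [Finset.sum_eq_single i]
    · simp
    · intro j _ hj
      rw [if_neg fun h => hj (hinj _ _ h)]
    · simp
  have hsupp : ∀ c, (P c).support ⊆
      (Finset.univ : Finset (Fin A × Fin B)).image (fun i => (i.1 : ℕ) + t * i.2) := by
    intro c n hn
    rw [mem_support_iff] at hn
    simp only [hPdef, finsetSum_coeff, coeff_monomial] at hn
    obtain ⟨i, -, hi⟩ := Finset.exists_ne_zero_of_sum_ne_zero hn
    simp only [ne_eq, ite_eq_right_iff, Classical.not_imp] at hi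
    exact Finset.mem_image.2 ⟨i, Finset.mem_univ _, hi.1⟩
  have hPz : ∀ c, (1 - X : K[X]) ^ t ∣ P c → P c = 0 := by
    intro c hc
    by_contra hne
    have hdeg : (P c).natDegree < p := by
      obtain ⟨i, -, hi⟩ := Finset.mem_image.1 (hsupp c (natDegree_mem_support_of_nonzero hne))
      rw [← hi]
      refine lt_of_lt_of_le ?_ htB
      have h1 := i.1.2
      have h2 : t * (i.2 + 1) ≤ t * B := Nat.mul_le_mul_left _ i.2.2
      rw [mul_add] at h2
      omega
    have hd : (X - 1 : K[X]) ^ t ∣ P c := by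
      rw [← neg_sub, neg_pow] at hc
      exact dvd_of_mul_left_dvd hc
    have h1 := lt_card_support_of_X_sub_one_pow_dvd (p := p) t (P c) hne hdeg hd
    have h2 := (Finset.card_le_card (hsupp c)).trans Finset.card_image_le
    simp at h2
    omega
  have hq : (1 - X : K[X]) ^ t ≠ 0 := by
    apply pow_ne_zero
    intro h
    have := congrArg (eval 0) h
    simp at this
  have hsum : ∑ c, P c * ((1 - X : K[X]) ^ t) ^ (c : ℕ) = 0 := by
    rw [← h0, stepanovPoly, ← Equiv.sum_comp (Equiv.prodAssoc (Fin A) (Fin B) (Fin B)),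
      Fintype.sum_prod_type_right]
    refine Finset.sum_congr rfl fun c _ => ?_
    rw [hPdef, Finset.sum_mul]
    refine Finset.sum_congr rfl fun i _ => ?_
    simp only [Equiv.prodAssoc_apply, ← C_mul_X_pow_eq_monomial, pow_add, ← pow_mul]
    ring
  have := eq_zero_of_sum_mul_pow_eq_zero hq B P hPz hsum
  funext ⟨a, b, c⟩
  rw [← hcoeff c (a, b), this c]
  simp

open Polynomial in
theorem natDegree_stepanovPoly_lt {K : Type*} [Field K] {t A B : ℕ} (hA : 0 < A)
    (hAt : A ≤ t) (hB : 0 < B) (l : Fin A × Fin B × Fin B → K) :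
    (stepanovPoly t A B l).natDegree < 2 * t * B := by
  have hpos : 0 < 2 * t * B := by
    have : 0 < t := by omega
    positivity
  refine Nat.lt_of_le_pred hpos (natDegree_sum_le_of_forall_le _ _ fun i _ => ?_)
  refine (natDegree_C_mul_le _ _).trans ?_
  refine natDegree_mul_le.trans ?_
  have h1 := natDegree_X_pow_le (R := K) (i.1 : ℕ)
  have h2 : (X ^ (t * (i.2.1 : ℕ)) * (1 - X : K[X]) ^ (t * (i.2.2 : ℕ))).natDegree ≤
      t * i.2.1 + t * i.2.2 := by
    refine natDegree_mul_le.trans (add_le_add (natDegree_X_pow_le _) ?_)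
    refine natDegree_pow_le.trans ?_
    have : (1 - X : K[X]).natDegree ≤ 1 := by
      refine (natDegree_sub_le _ _).trans ?_
      simp
    exact (Nat.mul_le_mul_left _ this).trans_eq (mul_one _)
  have h3 := i.1.2
  have h4 : t * (i.2.1 + 1) ≤ t * B := Nat.mul_le_mul_left _ i.2.1.2
  have h5 : t * (i.2.2 + 1) ≤ t * B := Nat.mul_le_mul_left _ i.2.2.2
  rw [mul_add] at h4 h5
  have h6 : 2 * t * B = t * B + t * B := by ring
  rw [Nat.pred_eq_sub_one]
  omega

/-- The differential operator `f ↦ X (1 - X) f'`. -/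
noncomputable def eulerOp (K : Type*) [Field K] : Polynomial K →ₗ[K] Polynomial K :=
  LinearMap.mulLeft K (Polynomial.X * (1 - Polynomial.X)) ∘ₗ Polynomial.derivative

/-- The conjugate of `eulerOp` by multiplication by `X ^ b * (1 - X) ^ c`. -/
noncomputable def twistedEulerOp (K : Type*) [Field K] (b c : ℕ) :
    Polynomial K →ₗ[K] Polynomial K :=
  eulerOp K + LinearMap.mulLeft K ((b : Polynomial K) * (1 - Polynomial.X)
    - (c : Polynomial K) * Polynomial.X)

open Polynomial in
theorem eulerOp_apply {K : Type*} [Field K] (f : K[X]) :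
    eulerOp K f = X * (1 - X) * derivative f := rfl

open Polynomial in
theorem twistedEulerOp_apply {K : Type*} [Field K] (b c : ℕ) (f : K[X]) :
    twistedEulerOp K b c f
      = X * (1 - X) * derivative f + ((b : K[X]) * (1 - X) - (c : K[X]) * X) * f := rfl

open Polynomial in
theorem X_mul_derivative_X_pow {K : Type*} [Field K] (b : ℕ) :
    X * derivative (X ^ b : K[X]) = (b : K[X]) * X ^ b := by
  rcases b with _ | b
  · simp
  · simp only [derivative_X_pow, Nat.add_sub_cancel, map_natCast]
    ring

open Polynomial in
theorem one_sub_X_mul_derivative_pow {K : Type*} [Field K] (c : ℕ) :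
    (1 - X) * derivative ((1 - X) ^ c : K[X]) = -(c : K[X]) * (1 - X) ^ c := by
  rcases c with _ | c
  · simp
  · simp only [derivative_pow, Nat.add_sub_cancel, map_natCast, derivative_sub, derivative_one,
      derivative_X]
    ring

open Polynomial in
theorem eulerOp_mul_X_pow_mul {K : Type*} [Field K] (b c : ℕ) (f : K[X]) :
    eulerOp K (f * (X ^ b * (1 - X) ^ c)) = twistedEulerOp K b c f * (X ^ b * (1 - X) ^ c) := by
  rw [eulerOp_apply, twistedEulerOp_apply, derivative_mul, derivative_mul]
  linear_combination f * (1 - X) * (1 - X) ^ c * X_mul_derivative_X_pow (K := K) b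
    + f * X * X ^ b * one_sub_X_mul_derivative_pow (K := K) c

open Polynomial in
theorem eulerOp_pow_mul_X_pow_mul {K : Type*} [Field K] (b c k : ℕ) (f : K[X]) :
    (eulerOp K ^ k) (f * (X ^ b * (1 - X) ^ c))
      = (twistedEulerOp K b c ^ k) f * (X ^ b * (1 - X) ^ c) := by
  induction k generalizing f with
  | zero => simp
  | succ k ih =>
    rw [pow_succ, Module.End.mul_apply, eulerOp_mul_X_pow_mul, ih, pow_succ, Module.End.mul_apply]

open Polynomial in
theorem natDegree_twistedEulerOp_le {K : Type*} [Field K] (b c : ℕ) (f : K[X]) :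
    (twistedEulerOp K b c f).natDegree ≤ f.natDegree + 1 := by
  rw [twistedEulerOp_apply]
  have h1 : (1 - X : K[X]).natDegree ≤ 1 := by
    refine (natDegree_sub_le _ _).trans ?_
    simp
  refine natDegree_add_le_of_degree_le ?_ ?_
  · by_cases h : derivative f = 0
    · simp [h]
    have hpos : f.natDegree ≠ 0 := by
      intro h0
      apply h
      rw [eq_C_of_natDegree_eq_zero h0]
      simp
    have h2 := natDegree_derivative_lt hpos
    have h3 : (X * (1 - X) : K[X]).natDegree ≤ 2 :=
      natDegree_mul_le.trans (by have := natDegree_X_le (R := K); omega)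
    refine natDegree_mul_le.trans ?_
    omega
  · refine natDegree_mul_le.trans ?_
    have : ((b : K[X]) * (1 - X) - (c : K[X]) * X).natDegree ≤ 1 := by
      refine (natDegree_sub_le_of_le (m := 1) (n := 1) (natDegree_mul_le.trans ?_)
        (natDegree_mul_le.trans ?_)).trans (by simp)
      · simpa using h1
      · simp
    omega

open Polynomial in
theorem natDegree_twistedEulerOp_pow_le {K : Type*} [Field K] (b c k : ℕ) (f : K[X]) :
    ((twistedEulerOp K b c ^ k) f).natDegree ≤ f.natDegree + k := by
  induction k with
  | zero => simp
  | succ k ih =>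
    rw [pow_succ', Module.End.mul_apply]
    exact (natDegree_twistedEulerOp_le _ _ _).trans (by omega)

open Polynomial in
theorem eval_eulerOp_pow_ne_zero {K : Type*} [Field K] {p : ℕ} [CharP K p] {x : K}
    (hx0 : x ≠ 0) (hx1 : x ≠ 1) (m : ℕ) (hm : m < p) (g : K[X]) (hg : g.eval x ≠ 0) :
    ((eulerOp K ^ m) ((X - C x) ^ m * g)).eval x ≠ 0 := by
  induction m generalizing g with
  | zero => simpa using hg
  | succ m ih =>
    have h : eulerOp K ((X - C x) ^ (m + 1) * g) = (X - C x) ^ m *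
        (X * (1 - X) * ((m + 1 : K[X]) * g + (X - C x) * derivative g)) := by
      rw [eulerOp_apply, derivative_mul, derivative_X_sub_C_pow]
      simp only [Nat.add_sub_cancel, Nat.cast_add, Nat.cast_one, map_add, map_natCast, map_one]
      ring
    rw [pow_succ, Module.End.mul_apply, h]
    refine ih (by omega) _ ?_
    have hm0 : ((m : K) + 1) ≠ 0 := by
      intro h
      have h1 : ((m + 1 : ℕ) : K) = 0 := by push_cast; exact h
      rw [CharP.cast_eq_zero_iff K p] at h1
      exact absurd (Nat.le_of_dvd (by omega) h1) (by omega)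
    simp only [eval_mul, eval_X, eval_sub, eval_one, eval_add, eval_natCast, eval_C, sub_self,
      zero_mul, add_zero]
    exact mul_ne_zero (mul_ne_zero hx0 (sub_ne_zero.2 hx1.symm)) (mul_ne_zero hm0 hg)

open Polynomial in
theorem le_rootMultiplicity_of_eval_eulerOp_pow {K : Type*} [Field K] {p : ℕ} [CharP K p] {x : K}
    (hx0 : x ≠ 0) (hx1 : x ≠ 1) {n : ℕ} (hn : n ≤ p) {f : K[X]} (hf : f ≠ 0)
    (h : ∀ k < n, ((eulerOp K ^ k) f).eval x = 0) : n ≤ f.rootMultiplicity x := by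
  by_contra! hlt
  obtain ⟨g, hfg, hg⟩ := exists_eq_pow_rootMultiplicity_mul_and_not_dvd f hf x
  rw [dvd_iff_isRoot, IsRoot.def] at hg
  have h1 := eval_eulerOp_pow_ne_zero (p := p) hx0 hx1 _ (hlt.trans_le hn) g hg
  rw [← hfg] at h1
  exact h1 (h _ hlt)

open Polynomial in
/-- Stepanov's method for the curves `x ^ t = α`, `(1 - x) ^ t = β`. -/
theorem stepanov_bound {K : Type*} [Field K] {p : ℕ} [CharP K p] {t A B : ℕ}
    (hA : 0 < A) (hB : 0 < B) (hAB : A * B ≤ t) (htB : t * B ≤ p) (H : Finset (K × K))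
    (hH : 2 * #H * A < B ^ 2) (S : Finset K)
    (hS : ∀ x ∈ S, x ≠ 0 ∧ x ≠ 1 ∧ (x ^ t, (1 - x) ^ t) ∈ H) :
    #S * A < 2 * t * B := by
  have hAt : A ≤ t := (Nat.le_mul_of_pos_right _ hB).trans hAB
  have hAp : A ≤ p := hAt.trans ((Nat.le_mul_of_pos_right _ hB).trans htB)
  let M : Matrix (H × Fin A × Fin (2 * A)) (Fin A × Fin B × Fin B) K := fun r i =>
    ((twistedEulerOp K (t * i.2.1) (t * i.2.2) ^ (r.2.1 : ℕ)) (X ^ (i.1 : ℕ))).coeff r.2.2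
      * ((r.1 : K × K).1 ^ (i.2.1 : ℕ) * (r.1 : K × K).2 ^ (i.2.2 : ℕ))
  have hker : LinearMap.ker M.mulVecLin ≠ ⊥ := by
    apply LinearMap.ker_ne_bot_of_finrank_lt
    simp only [Module.finrank_fintype_fun_eq_card, Fintype.card_prod, Fintype.card_fin,
      Fintype.card_coe]
    nlinarith
  obtain ⟨l, hl, hl0⟩ := (Submodule.ne_bot_iff _).1 hker
  rw [LinearMap.mem_ker, Matrix.mulVecLin_apply] at hl
  have hne := stepanovPoly_ne_zero (p := p) hAt hAB htB hl0
  have hmult : ∀ x ∈ S, A ≤ (stepanovPoly t A B l).rootMultiplicity x := by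
    intro x hx
    obtain ⟨hx0, hx1, hxH⟩ := hS x hx
    refine le_rootMultiplicity_of_eval_eulerOp_pow hx0 hx1 hAp hne fun k hk => ?_
    have h1 : ((eulerOp K ^ k) (stepanovPoly t A B l)).eval x = ∑ j : Fin (2 * A),
        M.mulVec l (⟨_, hxH⟩, ⟨k, hk⟩, j) * x ^ (j : ℕ) := by
      simp only [Matrix.mulVec, dotProduct, Finset.sum_mul]
      rw [Finset.sum_comm, stepanovPoly, map_sum, eval_finsetSum]
      refine Finset.sum_congr rfl fun i _ => ?_
      rw [← smul_eq_C_mul, map_smul, eulerOp_pow_mul_X_pow_mul, eval_smul, eval_mul,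
        eval_eq_sum_range' (n := 2 * A), Finset.sum_range]
      · simp only [M, eval_mul, eval_pow, eval_X, eval_sub, eval_one, smul_eq_mul, pow_mul]
        rw [Finset.sum_mul, Finset.mul_sum]
        refine Finset.sum_congr rfl fun j _ => ?_
        ring
      · refine (natDegree_twistedEulerOp_pow_le _ _ _ _).trans_lt ?_
        rw [natDegree_X_pow]
        have := i.1.2
        omega
    rw [h1, hl]
    simp
  have hle : A • S.val ≤ (stepanovPoly t A B l).roots := by
    classical
    rw [Multiset.le_iff_count]
    intro x
    rw [Multiset.count_nsmul, count_roots]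
    by_cases hx : x ∈ S
    · have := Multiset.count_eq_one_of_mem S.nodup hx
      rw [this, mul_one]
      exact hmult x hx
    · rw [Multiset.count_eq_zero_of_notMem (by simpa using hx)]
      simp
  have h1 := (Multiset.card_le_card hle).trans (card_roots' _)
  rw [Multiset.card_nsmul] at h1
  have h2 := natDegree_stepanovPoly_lt hA hAt hB l
  simp only [Finset.card_val] at h1
  rw [mul_comm]
  omega

theorem card_pow_three_le_of_stepanov {K : Type*} [Field K] {p : ℕ} [CharP K p] {t : ℕ}
    (ht : 0 < t) (htp : t ^ 2 ≤ p) (H : Finset (K × K)) (hH0 : H.Nonempty)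
    (hH : 8 * #H ≤ t ^ 2) (S : Finset K)
    (hS : ∀ x ∈ S, x ≠ 0 ∧ x ≠ 1 ∧ (x ^ t, (1 - x) ^ t) ∈ H) :
    #S ^ 3 ≤ 2 ^ 11 * (t * #H) ^ 2 := by
  set h := #H with hh
  have hpos : 0 < h := hH0.card_pos
  set A := Nat.findGreatest (fun A => 8 * h * A ^ 3 ≤ t ^ 2) t with hAdef
  have hA1 : 1 ≤ A := Nat.le_findGreatest ht (by simpa using hH)
  have hA : 8 * h * A ^ 3 ≤ t ^ 2 :=
    Nat.findGreatest_spec (P := fun A => 8 * h * A ^ 3 ≤ t ^ 2) ht (by simpa using hH)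
  have hA2 : t ^ 2 < 8 * h * (A + 1) ^ 3 := by
    by_cases hle : A + 1 ≤ t
    · exact not_le.1 (Nat.findGreatest_is_greatest (P := fun A => 8 * h * A ^ 3 ≤ t ^ 2)
        (Nat.lt_succ_self A) hle)
    · have h1 : t ^ 2 ≤ (A + 1) ^ 2 := Nat.pow_le_pow_left (by omega) 2
      have h2 : (A + 1) ^ 2 < (A + 1) ^ 3 := Nat.pow_lt_pow_right (by omega) (by omega)
      nlinarith
  have hA3 : t ^ 2 ≤ 64 * h * A ^ 3 := by
    have h1 : (A + 1) ^ 3 ≤ (2 * A) ^ 3 := Nat.pow_le_pow_left (by omega) 3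
    calc t ^ 2 ≤ 8 * h * (A + 1) ^ 3 := hA2.le
      _ ≤ 8 * h * (2 * A) ^ 3 := Nat.mul_le_mul_left _ h1
      _ = _ := by ring
  set r := Nat.sqrt (2 * h * A) with hr
  have hr1 : 1 ≤ r := Nat.le_sqrt'.2 (by nlinarith)
  have hr2 : r ^ 2 ≤ 2 * h * A := Nat.sqrt_le' _
  have hr3 : 2 * h * A < (r + 1) ^ 2 := Nat.lt_succ_sqrt' _
  have hB : (r + 1) ^ 2 ≤ 8 * h * A := by nlinarith
  have hAB : A * (r + 1) ≤ t := by
    refine (Nat.pow_le_pow_iff_left two_ne_zero).1 ?_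
    calc (A * (r + 1)) ^ 2 = A ^ 2 * (r + 1) ^ 2 := by ring
      _ ≤ A ^ 2 * (8 * h * A) := Nat.mul_le_mul_left _ hB
      _ = 8 * h * A ^ 3 := by ring
      _ ≤ t ^ 2 := hA
  have htB : t * (r + 1) ≤ p := by
    refine le_trans ?_ htp
    rw [pow_two]
    exact Nat.mul_le_mul_left _ ((Nat.le_mul_of_pos_left _ hA1).trans hAB)
  have key := stepanov_bound (p := p) hA1 (Nat.succ_pos r) hAB htB H hr3 S hS
  set s := #S
  have h1 : s ^ 2 * A ≤ 32 * t ^ 2 * h := by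
    refine Nat.le_of_mul_le_mul_right ?_ hA1
    calc s ^ 2 * A * A = (s * A) ^ 2 := by ring
      _ ≤ (2 * t * (r + 1)) ^ 2 := Nat.pow_le_pow_left key.le 2
      _ = 4 * t ^ 2 * (r + 1) ^ 2 := by ring
      _ ≤ 4 * t ^ 2 * (8 * h * A) := Nat.mul_le_mul_left _ hB
      _ = _ := by ring
  have h2 : s ^ 6 ≤ 2 ^ 21 * t ^ 4 * h ^ 4 := by
    refine Nat.le_of_mul_le_mul_right ?_ (pow_pos ht 2)
    calc s ^ 6 * t ^ 2 ≤ s ^ 6 * (64 * h * A ^ 3) := Nat.mul_le_mul_left _ hA3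
      _ = 64 * h * (s ^ 2 * A) ^ 3 := by ring
      _ ≤ 64 * h * (32 * t ^ 2 * h) ^ 3 := Nat.mul_le_mul_left _ (Nat.pow_le_pow_left h1 3)
      _ = _ := by ring
  refine (Nat.pow_le_pow_iff_left two_ne_zero).1 ?_
  calc (s ^ 3) ^ 2 = s ^ 6 := by ring
    _ ≤ 2 ^ 21 * t ^ 4 * h ^ 4 := h2
    _ ≤ 2 ^ 22 * t ^ 4 * h ^ 4 := by gcongr <;> norm_num
    _ = _ := by ring

/-- `Γ` is (the underlying set of) a multiplicative subgroup of `K`. -/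
structure IsMulSubgroup {K : Type*} [Field K] (Γ : Finset K) : Prop where
  zero_notMem : (0 : K) ∉ Γ
  one_mem : (1 : K) ∈ Γ
  mul_mem : ∀ x ∈ Γ, ∀ y ∈ Γ, x * y ∈ Γ
  inv_mem : ∀ x ∈ Γ, x⁻¹ ∈ Γ

theorem IsMulSubgroup.card_pos {K : Type*} [Field K] {Γ : Finset K} (hΓ : IsMulSubgroup Γ) :
    0 < #Γ := Finset.card_pos.2 ⟨1, hΓ.one_mem⟩

theorem IsMulSubgroup.ne_zero {K : Type*} [Field K] {Γ : Finset K} (hΓ : IsMulSubgroup Γ)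
    {x : K} (hx : x ∈ Γ) : x ≠ 0 := fun h => hΓ.zero_notMem (h ▸ hx)

theorem IsMulSubgroup.pow_card {K : Type*} [Field K] {Γ : Finset K} (hΓ : IsMulSubgroup Γ)
    {x : K} (hx : x ∈ Γ) : x ^ #Γ = 1 := by
  classical
  have hx0 := hΓ.ne_zero hx
  have himg : Γ.image (x * ·) = Γ := by
    refine Finset.eq_of_subset_of_card_le ?_ ?_
    · exact Finset.image_subset_iff.2 fun y hy => hΓ.mul_mem x hx y hy
    · rw [Finset.card_image_of_injective _ (mul_right_injective₀ hx0)]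
  have h : ∏ y ∈ Γ, y = x ^ #Γ * ∏ y ∈ Γ, y := by
    conv_lhs => rw [← himg, Finset.prod_image (fun a _ b _ h => mul_right_injective₀ hx0 h)]
    rw [Finset.prod_mul_distrib, Finset.prod_const]
  have hne : ∏ y ∈ Γ, y ≠ 0 := Finset.prod_ne_zero_iff.2 fun y hy => hΓ.ne_zero hy
  exact (mul_eq_right₀ hne).1 h.symm

/-- The pairs `(u, v) ∈ U × V` with `v - u ∈ Γ`. -/
def incidences {K : Type*} [Field K] [DecidableEq K] (Γ U V : Finset K) : Finset (K × K) :=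
  {q ∈ U ×ˢ V | q.2 - q.1 ∈ Γ}

theorem mem_incidences {K : Type*} [Field K] [DecidableEq K] {Γ U V : Finset K} {q : K × K} :
    q ∈ incidences Γ U V ↔ q.1 ∈ U ∧ q.2 ∈ V ∧ q.2 - q.1 ∈ Γ := by
  simp [incidences, and_assoc]

theorem card_incidences_le_left {K : Type*} [Field K] [DecidableEq K] (Γ U V : Finset K) :
    #(incidences Γ U V) ≤ #Γ * #U := by
  rw [mul_comm, ← Finset.card_product]
  refine Finset.card_le_card_of_injOn (fun q => (q.1, q.2 - q.1)) ?_ ?_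
  · intro q hq
    have := mem_incidences.1 hq
    simp [this.1, this.2.2]
  · rintro ⟨a, b⟩ - ⟨c, d⟩ - h
    simp only [Prod.mk.injEq] at h
    obtain ⟨rfl, h⟩ := h
    simpa using h

theorem card_incidences_le_right {K : Type*} [Field K] [DecidableEq K] (Γ U V : Finset K) :
    #(incidences Γ U V) ≤ #Γ * #V := by
  rw [mul_comm, ← Finset.card_product]
  refine Finset.card_le_card_of_injOn (fun q => (q.2, q.2 - q.1)) ?_ ?_
  · intro q hq
    have := mem_incidences.1 hq
    simp [this.2.1, this.2.2]
  · rintro ⟨a, b⟩ - ⟨c, d⟩ - h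
    simp only [Prod.mk.injEq] at h
    obtain ⟨rfl, h⟩ := h
    simpa using h

theorem card_le_of_invariant {K : Type*} [Field K] {Γ U : Finset K}
    (hU : ∀ x ∈ Γ, ∀ u ∈ U, x * u ∈ U) {u : K} (hu : u ∈ U) (hu0 : u ≠ 0) : #Γ ≤ #U :=
  Finset.card_le_card_of_injOn (· * u) (fun x hx => hU x hx u hu)
    (fun _ _ _ _ h => mul_left_injective₀ hu0 h)

theorem card_incidences_pow_three_le_of_ne_zero {K : Type*} [Field K] [DecidableEq K] {p : ℕ}
    [CharP K p] {Γ U V : Finset K} (hΓ : IsMulSubgroup Γ) (hp : #Γ ^ 2 ≤ p)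
    (hU : ∀ x ∈ Γ, ∀ u ∈ U, x * u ∈ U) (hV : ∀ x ∈ Γ, ∀ v ∈ V, x * v ∈ V)
    (hU0 : (0 : K) ∉ U) (hV0 : (0 : K) ∉ V) :
    #(incidences Γ U V) ^ 3 ≤ 2 ^ 11 * #Γ * (#U * #V) ^ 2 := by
  have hUne : ∀ u ∈ U, u ≠ 0 := fun u hu h => hU0 (h ▸ hu)
  have hVne : ∀ v ∈ V, v ≠ 0 := fun v hv h => hV0 (h ▸ hv)
  rcases (incidences Γ U V).eq_empty_or_nonempty with he | ⟨q₀, hq₀⟩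
  · simp [he]
  set t := #Γ with ht
  have htpos : 0 < t := hΓ.card_pos
  set E := #(incidences Γ U V)
  set φ : K × K → K × K := fun q => ((q.1 / q.2) ^ t, (q.2⁻¹) ^ t) with hφ
  set H := (U ×ˢ V).image φ with hHdef
  have hH0 : H.Nonempty := by
    have := mem_incidences.1 hq₀
    exact ⟨_, Finset.mem_image_of_mem φ (Finset.mem_product.2 ⟨this.1, this.2.1⟩)⟩
  have hHcard : t ^ 2 * #H ≤ #U * #V := by
    rw [← Finset.card_product]
    refine Finset.mul_card_image_le_card _ _ fun a ha => ?_
    obtain ⟨⟨u, v⟩, huv, rfl⟩ := Finset.mem_image.1 ha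
    obtain ⟨hu, hv⟩ := Finset.mem_product.1 huv
    rw [pow_two, ht, ← Finset.card_product]
    refine Finset.card_le_card_of_injOn (fun q => (q.1 * u, q.2 * v)) ?_ ?_
    · rintro ⟨x, y⟩ hxy
      obtain ⟨hx, hy⟩ := Finset.mem_product.1 hxy
      simp only [Finset.coe_filter, Set.mem_ofPred_eq, Finset.mem_product]
      refine ⟨⟨hU x hx u hu, hV y hy v hv⟩, ?_⟩
      have h1 := hΓ.pow_card hx
      have h2 := hΓ.pow_card hy
      rw [← ht] at h1 h2
      simp only [hφ, div_pow, mul_pow, inv_pow, h1, h2, one_mul]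
    · rintro ⟨x, y⟩ - ⟨x', y'⟩ - h
      simp only [Prod.mk.injEq] at h
      exact Prod.ext (mul_left_injective₀ (hUne u hu) h.1) (mul_left_injective₀ (hVne v hv) h.2)
  by_cases hbig : 8 * #H ≤ t ^ 2
  · set S := (incidences Γ U V).image (fun q => q.1 / q.2) with hSdef
    have hS : ∀ x ∈ S, x ≠ 0 ∧ x ≠ 1 ∧ (x ^ t, (1 - x) ^ t) ∈ H := by
      intro x hx
      obtain ⟨⟨u, v⟩, hq, rfl⟩ := Finset.mem_image.1 hx
      obtain ⟨hu, hv, hγ⟩ := mem_incidences.1 hq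
      simp only at hu hv hγ
      have hu0 := hUne u hu
      have hv0 := hVne v hv
      have h1 : 1 - u / v = (v - u) / v := by field_simp
      refine ⟨div_ne_zero hu0 hv0, ?_, ?_⟩
      · intro h
        rw [h, sub_self, eq_comm, div_eq_zero_iff] at h1
        exact h1.elim (hΓ.ne_zero hγ) hv0
      · refine Finset.mem_image.2 ⟨(u, v), Finset.mem_product.2 ⟨hu, hv⟩, ?_⟩
        simp only [hφ, h1]
        rw [div_pow (v - u), hΓ.pow_card hγ, inv_pow, one_div]
    have hES : E ≤ #S * t := by
      rw [ht, ← Finset.card_product]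
      refine Finset.card_le_card_of_injOn (fun q => (q.1 / q.2, q.2 - q.1)) ?_ ?_
      · intro q hq
        exact Finset.mem_product.2 ⟨Finset.mem_image_of_mem _ hq, (mem_incidences.1 hq).2.2⟩
      · rintro ⟨u, v⟩ hq ⟨u', v'⟩ hq' h
        obtain ⟨hu, hv, hγ⟩ := mem_incidences.1 hq
        obtain ⟨hu', hv', hγ'⟩ := mem_incidences.1 hq'
        simp only [Prod.mk.injEq] at h hu hv hγ hu' hv' hγ'
        obtain ⟨h1, h2⟩ := h
        have hv0 := hVne v hv
        have hv0' := hVne v' hv'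
        rw [div_eq_div_iff hv0 hv0'] at h1
        have h3 : (v - u) * (v' - v) = 0 := by linear_combination -v * h2 - h1
        have h4 : v = v' := (sub_eq_zero.1 ((mul_eq_zero.1 h3).resolve_left (hΓ.ne_zero hγ))).symm
        subst h4
        exact Prod.ext (by linear_combination -h2) rfl
    have hS3 := card_pow_three_le_of_stepanov (p := p) htpos hp H hH0 hbig S hS
    calc E ^ 3 ≤ (#S * t) ^ 3 := Nat.pow_le_pow_left hES 3
      _ = t ^ 3 * #S ^ 3 := by ring
      _ ≤ t ^ 3 * (2 ^ 11 * (t * #H) ^ 2) := Nat.mul_le_mul_left _ hS3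
      _ = 2 ^ 11 * t * (t ^ 2 * #H) ^ 2 := by ring
      _ ≤ _ := Nat.mul_le_mul_left _ (Nat.pow_le_pow_left hHcard 2)
  · have h1 : t ^ 4 ≤ 8 * (#U * #V) := by
      calc t ^ 4 = t ^ 2 * t ^ 2 := by ring
        _ ≤ t ^ 2 * (8 * #H) := Nat.mul_le_mul_left _ (not_le.1 hbig).le
        _ = 8 * (t ^ 2 * #H) := by ring
        _ ≤ _ := Nat.mul_le_mul_left _ hHcard
    have h2 : E ^ 2 ≤ t ^ 2 * (#U * #V) := by
      calc E ^ 2 = E * E := by ring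
        _ ≤ (t * #U) * (t * #V) :=
          Nat.mul_le_mul (card_incidences_le_left Γ U V) (card_incidences_le_right Γ U V)
        _ = _ := by ring
    refine (Nat.pow_le_pow_iff_left two_ne_zero).1 ?_
    calc (E ^ 3) ^ 2 = (E ^ 2) ^ 3 := by ring
      _ ≤ (t ^ 2 * (#U * #V)) ^ 3 := Nat.pow_le_pow_left h2 3
      _ = t ^ 4 * (t ^ 2 * (#U * #V) ^ 3) := by ring
      _ ≤ (8 * (#U * #V)) * (t ^ 2 * (#U * #V) ^ 3) := Nat.mul_le_mul_right _ h1
      _ = 8 * (t ^ 2 * (#U * #V) ^ 4) := by ring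
      _ ≤ 2 ^ 22 * (t ^ 2 * (#U * #V) ^ 4) := Nat.mul_le_mul_right _ (by norm_num)
      _ = _ := by ring

theorem card_incidences_pow_three_le {K : Type*} [Field K] [DecidableEq K] {p : ℕ}
    [CharP K p] {Γ U V : Finset K} (hΓ : IsMulSubgroup Γ) (hp : #Γ ^ 2 ≤ p)
    (hU : ∀ x ∈ Γ, ∀ u ∈ U, x * u ∈ U) (hV : ∀ x ∈ Γ, ∀ v ∈ V, x * v ∈ V) :
    #(incidences Γ U V) ^ 3 ≤ 2 ^ 15 * #Γ * (#U * #V) ^ 2 := by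
  have hU' : ∀ x ∈ Γ, ∀ u ∈ U.erase 0, x * u ∈ U.erase 0 := fun x hx u hu =>
    Finset.mem_erase.2 ⟨mul_ne_zero (hΓ.ne_zero hx) (Finset.ne_of_mem_erase hu),
      hU x hx u (Finset.mem_of_mem_erase hu)⟩
  have hV' : ∀ x ∈ Γ, ∀ u ∈ V.erase 0, x * u ∈ V.erase 0 := fun x hx u hu =>
    Finset.mem_erase.2 ⟨mul_ne_zero (hΓ.ne_zero hx) (Finset.ne_of_mem_erase hu),
      hV x hx u (Finset.mem_of_mem_erase hu)⟩
  have hmain : #(incidences Γ (U.erase 0) (V.erase 0)) ^ 3 ≤ 2 ^ 11 * #Γ * (#U * #V) ^ 2 := by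
    refine (card_incidences_pow_three_le_of_ne_zero (p := p) hΓ hp hU' hV' (by simp)
      (by simp)).trans ?_
    gcongr <;> exact Finset.erase_subset _ _
  set Z₁ := {q ∈ incidences Γ U V | q.1 = 0} with hZ₁
  set Z₂ := {q ∈ incidences Γ U V | q.2 = 0} with hZ₂
  have hb₁ : #Z₁ ^ 3 ≤ #Γ * (#U * #V) ^ 2 := by
    rcases Z₁.eq_empty_or_nonempty with he | ⟨⟨u, v⟩, hq⟩
    · simp [he]
    obtain ⟨hq, rfl⟩ : (u, v) ∈ incidences Γ U V ∧ u = 0 := by simpa [hZ₁] using hq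
    obtain ⟨hu, hv, hγ⟩ := mem_incidences.1 hq
    simp only [sub_zero] at hu hv hγ
    have h1 : #Z₁ ≤ #Γ := by
      refine Finset.card_le_card_of_injOn (fun q => q.2) ?_ ?_
      · rintro ⟨a, b⟩ h
        obtain ⟨h, rfl⟩ : (a, b) ∈ incidences Γ U V ∧ a = 0 := by simpa [hZ₁] using h
        simpa using (mem_incidences.1 h).2.2
      · rintro ⟨a, b⟩ h ⟨c, d⟩ h' hbd
        obtain ⟨-, rfl⟩ : (a, b) ∈ incidences Γ U V ∧ a = 0 := by simpa [hZ₁] using h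
        obtain ⟨-, rfl⟩ : (c, d) ∈ incidences Γ U V ∧ c = 0 := by simpa [hZ₁] using h'
        exact Prod.ext rfl hbd
    have h2 : #Γ ≤ #V := card_le_of_invariant hV hv (hΓ.ne_zero hγ)
    have h3 : 1 ≤ #U := Finset.card_pos.2 ⟨0, hu⟩
    calc #Z₁ ^ 3 ≤ #Γ ^ 3 := Nat.pow_le_pow_left h1 3
      _ = #Γ * (1 * #Γ) ^ 2 := by ring
      _ ≤ _ := by gcongr
  have hb₂ : #Z₂ ^ 3 ≤ #Γ * (#U * #V) ^ 2 := by
    rcases Z₂.eq_empty_or_nonempty with he | ⟨⟨u, v⟩, hq⟩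
    · simp [he]
    obtain ⟨hq, rfl⟩ : (u, v) ∈ incidences Γ U V ∧ v = 0 := by simpa [hZ₂] using hq
    obtain ⟨hu, hv, hγ⟩ := mem_incidences.1 hq
    simp only [zero_sub] at hu hv hγ
    have h1 : #Z₂ ≤ #Γ := by
      refine Finset.card_le_card_of_injOn (fun q => -q.1) ?_ ?_
      · rintro ⟨a, b⟩ h
        obtain ⟨h, rfl⟩ : (a, b) ∈ incidences Γ U V ∧ b = 0 := by simpa [hZ₂] using h
        simpa using (mem_incidences.1 h).2.2
      · rintro ⟨a, b⟩ h ⟨c, d⟩ h' hbd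
        obtain ⟨-, rfl⟩ : (a, b) ∈ incidences Γ U V ∧ b = 0 := by simpa [hZ₂] using h
        obtain ⟨-, rfl⟩ : (c, d) ∈ incidences Γ U V ∧ d = 0 := by simpa [hZ₂] using h'
        exact Prod.ext (neg_injective hbd) rfl
    have h2 : #Γ ≤ #U := card_le_of_invariant hU hu (neg_ne_zero.1 (hΓ.ne_zero hγ))
    have h3 : 1 ≤ #V := Finset.card_pos.2 ⟨0, hv⟩
    calc #Z₂ ^ 3 ≤ #Γ ^ 3 := Nat.pow_le_pow_left h1 3
      _ = #Γ * (#Γ * 1) ^ 2 := by ring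
      _ ≤ _ := by gcongr
  have hcover : #(incidences Γ U V) ≤ #(incidences Γ (U.erase 0) (V.erase 0)) + #Z₁ + #Z₂ := by
    have hsub : incidences Γ U V ⊆ incidences Γ (U.erase 0) (V.erase 0) ∪ Z₁ ∪ Z₂ := by
      intro q hq
      have h := mem_incidences.1 hq
      simp only [Finset.mem_union, mem_incidences, Finset.mem_erase, hZ₁, hZ₂, Finset.mem_filter]
      tauto
    exact (Finset.card_le_card hsub).trans ((Finset.card_union_le _ _).trans
      (Nat.add_le_add_right (Finset.card_union_le _ _) _))
  have hpow : ∀ a b c : ℕ, (a + b + c) ^ 3 ≤ 9 * (a ^ 3 + b ^ 3 + c ^ 3) := by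
    intro a b c
    zify
    have ha : (0 : ℤ) ≤ a := by positivity
    have hb : (0 : ℤ) ≤ b := by positivity
    have hc : (0 : ℤ) ≤ c := by positivity
    nlinarith [mul_nonneg (add_nonneg ha hb) (sq_nonneg ((a : ℤ) - b)),
      mul_nonneg (add_nonneg hb hc) (sq_nonneg ((b : ℤ) - c)),
      mul_nonneg (add_nonneg ha hc) (sq_nonneg ((a : ℤ) - c)),
      mul_nonneg (add_nonneg (add_nonneg ha hb) hc) (add_nonneg (add_nonneg
        (sq_nonneg ((a : ℤ) - b)) (sq_nonneg ((b : ℤ) - c))) (sq_nonneg ((a : ℤ) - c)))]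
  calc #(incidences Γ U V) ^ 3
      ≤ (#(incidences Γ (U.erase 0) (V.erase 0)) + #Z₁ + #Z₂) ^ 3 := Nat.pow_le_pow_left hcover 3
    _ ≤ _ := hpow _ _ _
    _ ≤ 9 * (2 ^ 11 * #Γ * (#U * #V) ^ 2 + #Γ * (#U * #V) ^ 2 + #Γ * (#U * #V) ^ 2) := by gcongr
    _ = (9 * (2 ^ 11 + 2)) * (#Γ * (#U * #V) ^ 2) := by ring
    _ ≤ 2 ^ 15 * (#Γ * (#U * #V) ^ 2) := Nat.mul_le_mul_right _ (by norm_num)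
    _ = _ := by ring

theorem sum_sq_filter_le_of_weak_type {α : Type*} [Fintype α] (c : α → ℝ) (hc : ∀ a, 0 ≤ c a)
    {M : ℝ} (hM : 0 ≤ M) (h : ∀ r : ℝ, 0 < r → r ^ 3 * #{a | r ≤ c a} ≤ M) {r : ℝ} (hr : 0 < r) :
    ∑ a with r ≤ c a, c a ^ 2 ≤ 8 * M / r := by
  have key : ∀ n : ℕ, ∀ r : ℝ, 0 < r → ∑ a, c a < r * 2 ^ n →
      ∑ a with r ≤ c a, c a ^ 2 ≤ 8 * M / r := by
    intro n
    induction n with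
    | zero =>
      intro r hr hlt
      rw [Finset.filter_false_of_mem, Finset.sum_empty]
      · positivity
      · intro a _ hle
        have := Finset.single_le_sum (fun a _ => hc a) (Finset.mem_univ a)
        linarith
    | succ n ih =>
      intro r hr hlt
      have h1 := ih (2 * r) (by positivity) (by rw [pow_succ] at hlt; linarith)
      have h2 : ∑ a with r ≤ c a, c a ^ 2 ≤
          (2 * r) ^ 2 * #{a | r ≤ c a} + ∑ a with 2 * r ≤ c a, c a ^ 2 := by
        rw [mul_comm, ← nsmul_eq_mul, ← Finset.sum_const, Finset.sum_filter, Finset.sum_filter,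
          Finset.sum_filter, ← Finset.sum_add_distrib]
        refine Finset.sum_le_sum fun a _ => ?_
        have := hc a
        split_ifs with h3 h4 h4
        · nlinarith
        · nlinarith
        · linarith
        · simp
      have h3 : (2 * r) ^ 2 * #{a | r ≤ c a} ≤ 4 * M / r := by
        rw [le_div_iff₀ hr]
        have := h r hr
        nlinarith
      have h4 : 8 * M / (2 * r) = 4 * M / r := by field_simp; ring
      have h5 : 8 * M / r = 4 * M / r + 4 * M / r := by ring
      linarith
  obtain ⟨n, hn⟩ := pow_unbounded_of_one_lt ((∑ a, c a) / r) (one_lt_two (α := ℝ))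
  exact key n r hr (by rwa [div_lt_iff₀' hr] at hn)

/-- The convolution `v ↦ ∑_{v - u ∈ Γ} f u` of `f` with the indicator function of `Γ`. -/
def convIndicator {K : Type*} [Field K] [Fintype K] [DecidableEq K] (Γ : Finset K) (f : K → ℝ)
    (v : K) : ℝ := ∑ u with v - u ∈ Γ, f u

theorem convIndicator_nonneg {K : Type*} [Field K] [Fintype K] [DecidableEq K] {Γ : Finset K}
    {f : K → ℝ} (hf : ∀ u, 0 ≤ f u) (v : K) : 0 ≤ convIndicator Γ f v :=
  Finset.sum_nonneg fun u _ => hf u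

theorem sum_convIndicator {K : Type*} [Field K] [Fintype K] [DecidableEq K] (Γ V : Finset K)
    (f : K → ℝ) : ∑ v ∈ V, convIndicator Γ f v = ∑ u, f u * #{v ∈ V | v - u ∈ Γ} := by
  simp only [convIndicator, Finset.sum_filter]
  rw [Finset.sum_comm]
  refine Finset.sum_congr rfl fun u _ => ?_
  rw [← Finset.sum_filter, Finset.sum_const, nsmul_eq_mul, mul_comm]

theorem sum_univ_convIndicator {K : Type*} [Field K] [Fintype K] [DecidableEq K] (Γ : Finset K)
    (f : K → ℝ) : ∑ v, convIndicator Γ f v = #Γ * ∑ u, f u := by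
  rw [sum_convIndicator, Finset.mul_sum]
  refine Finset.sum_congr rfl fun u _ => ?_
  rw [mul_comm]
  congr 2
  refine Finset.card_nbij' (fun v => v - u) (fun x => x + u) ?_ ?_ ?_ ?_
  · intro v hv; simpa using hv
  · intro x hx; simpa using hx
  · intro v _; simp
  · intro x _; simp

theorem IsMulSubgroup.mul_sub_mul_mem_iff {K : Type*} [Field K] [DecidableEq K] {Γ : Finset K}
    (hΓ : IsMulSubgroup Γ) {x : K} (hx : x ∈ Γ) (u v : K) :
    x * v - x * u ∈ Γ ↔ v - u ∈ Γ := by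
  rw [← mul_sub]
  refine ⟨fun h => ?_, fun h => hΓ.mul_mem x hx _ h⟩
  have := hΓ.mul_mem _ (hΓ.inv_mem x hx) _ h
  rwa [inv_mul_cancel_left₀ (hΓ.ne_zero hx)] at this

theorem convIndicator_mul {K : Type*} [Field K] [Fintype K] [DecidableEq K] {Γ : Finset K}
    (hΓ : IsMulSubgroup Γ) {f : K → ℝ}
    (hf : ∀ x ∈ Γ, ∀ u, f (x * u) = f u) (x : K) (hx : x ∈ Γ) (v : K) :
    convIndicator Γ f (x * v) = convIndicator Γ f v := by
  simp only [convIndicator, Finset.sum_filter]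
  rw [← Equiv.sum_comp (Equiv.mulLeft₀ x (hΓ.ne_zero hx))]
  refine Finset.sum_congr rfl fun u _ => ?_
  simp only [Equiv.mulLeft₀_apply, IsMulSubgroup.mul_sub_mul_mem_iff hΓ hx, hf x hx]

theorem card_incidences_weak_type {K : Type*} [Field K] [Fintype K] [DecidableEq K] {p : ℕ}
    [CharP K p] {Γ V : Finset K} (hΓ : IsMulSubgroup Γ)
    (hp : #Γ ^ 2 ≤ p) (hV : ∀ x ∈ Γ, ∀ v ∈ V, x * v ∈ V) (r : ℝ) (hr : 0 < r) :
    r ^ 3 * #{u | r ≤ (#{v ∈ V | v - u ∈ Γ} : ℝ)} ≤ 2 ^ 15 * #Γ * (#V : ℝ) ^ 2 := by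
  set W : Finset K := {u | r ≤ (#{v ∈ V | v - u ∈ Γ} : ℝ)} with hW
  have hWinv : ∀ x ∈ Γ, ∀ u ∈ W, x * u ∈ W := by
    intro x hx u hu
    simp only [hW, Finset.mem_filter, Finset.mem_univ, true_and] at hu ⊢
    refine hu.trans (Nat.cast_le.2 ?_)
    refine Finset.card_le_card_of_injOn (x * ·) ?_
      (fun _ _ _ _ h => mul_right_injective₀ (hΓ.ne_zero hx) h)
    intro v hv
    have hv := Finset.mem_filter.1 hv
    exact Finset.mem_filter.2 ⟨hV x hx v hv.1,
      (IsMulSubgroup.mul_sub_mul_mem_iff hΓ hx u v).2 hv.2⟩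
  have h1 := card_incidences_pow_three_le (p := p) hΓ hp hWinv hV
  have h2 : r * #W ≤ #(incidences Γ W V) := by
    have : #(incidences Γ W V) = ∑ u ∈ W, #{v ∈ V | v - u ∈ Γ} := by
      simp only [incidences, Finset.card_filter, Finset.sum_product]
    rw [this, Nat.cast_sum, mul_comm, ← nsmul_eq_mul]
    exact Finset.card_nsmul_le_sum _ _ _ fun u hu => (Finset.mem_filter.1 hu).2
  rcases W.eq_empty_or_nonempty with he | hne
  · rw [he]; simp; positivity
  have hWpos : (0 : ℝ) < #W := by exact_mod_cast hne.card_pos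
  have h3 : (r * #W) ^ 3 ≤ 2 ^ 15 * #Γ * (#W * #V : ℝ) ^ 2 :=
    (pow_le_pow_left₀ (by positivity) h2 3).trans (by exact_mod_cast h1)
  refine le_of_mul_le_mul_right ?_ (pow_pos hWpos 2)
  linarith [h3]

theorem convIndicator_weak_type {K : Type*} [Field K] [Fintype K] [DecidableEq K] {p : ℕ}
    [CharP K p] {Γ : Finset K} (hΓ : IsMulSubgroup Γ)
    (hp : #Γ ^ 2 ≤ p) {f : K → ℝ} (hf0 : ∀ u, 0 ≤ f u) (hf : ∀ x ∈ Γ, ∀ u, f (x * u) = f u)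
    (hs : 0 < ∑ u, f u) (r : ℝ) (hr : 0 < r) :
    r ^ 3 * #{v | r ≤ convIndicator Γ f v} ≤ 2 ^ 21 * #Γ * (∑ u, f u) * ∑ u, f u ^ 2 := by
  set V : Finset K := {v | r ≤ convIndicator Γ f v} with hVdef
  set s := ∑ u, f u with hsdef
  set T := ∑ u, f u ^ 2 with hT
  have hT0 : 0 ≤ T := Finset.sum_nonneg fun u _ => sq_nonneg _
  have hV : ∀ x ∈ Γ, ∀ v ∈ V, x * v ∈ V := by
    intro x hx v hv
    simpa [hVdef, convIndicator_mul hΓ hf x hx] using hv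
  rcases V.eq_empty_or_nonempty with he | hne
  · rw [he]; simp; positivity
  have hVpos : (0 : ℝ) < #V := by exact_mod_cast hne.card_pos
  set c : K → ℝ := fun u => (#{v ∈ V | v - u ∈ Γ} : ℝ) with hc
  set q := r * #V / (2 * s) with hq
  have hqpos : 0 < q := by positivity
  have htail : ∑ u with q ≤ c u, c u ^ 2 ≤ 8 * (2 ^ 15 * #Γ * (#V : ℝ) ^ 2) / q :=
    sum_sq_filter_le_of_weak_type c (fun u => Nat.cast_nonneg _) (by positivity)
      (card_incidences_weak_type (p := p) hΓ hp hV) hqpos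
  have h1 : r * #V ≤ ∑ u, f u * c u := by
    rw [← sum_convIndicator, mul_comm, ← nsmul_eq_mul]
    exact Finset.card_nsmul_le_sum _ _ _ fun v hv => (Finset.mem_filter.1 hv).2
  have h2 : ∑ u, f u * c u ≤ q * s + ∑ u with q ≤ c u, f u * c u := by
    rw [hsdef, Finset.mul_sum, Finset.sum_filter, ← Finset.sum_add_distrib]
    refine Finset.sum_le_sum fun u _ => ?_
    have := hf0 u
    split_ifs with h
    · nlinarith
    · nlinarith
  have h3 : q * s = r * #V / 2 := by rw [hq]; field_simp
  have h4 : r * #V / 2 ≤ ∑ u with q ≤ c u, f u * c u := by linarith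
  have h5 : (∑ u with q ≤ c u, f u * c u) ^ 2 ≤ T * (8 * (2 ^ 15 * #Γ * (#V : ℝ) ^ 2) / q) := by
    refine (Finset.sum_mul_sq_le_sq_mul_sq _ _ _).trans ?_
    refine mul_le_mul ?_ htail (Finset.sum_nonneg fun u _ => sq_nonneg _) hT0
    exact Finset.sum_le_sum_of_subset_of_nonneg (Finset.filter_subset _ _)
      fun u _ _ => sq_nonneg _
  have h6 : (r * #V / 2) ^ 2 ≤ T * (8 * (2 ^ 15 * #Γ * (#V : ℝ) ^ 2) / q) :=
    (pow_le_pow_left₀ (by positivity) h4 2).trans h5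
  rw [← mul_div_assoc, le_div_iff₀ hqpos] at h6
  refine le_of_mul_le_mul_right ?_ (pow_pos hVpos 2)
  have h7 : (r * #V / 2) ^ 2 * q * (8 * s) = r ^ 3 * #V * (#V : ℝ) ^ 2 := by
    rw [hq]; field_simp; ring
  rw [← h7]
  calc _ ≤ T * (8 * (2 ^ 15 * #Γ * (#V : ℝ) ^ 2)) * (8 * s) := by gcongr
    _ = _ := by ring

theorem sum_sq_convIndicator_le {K : Type*} [Field K] [Fintype K] [DecidableEq K] {p : ℕ}
    [CharP K p] {Γ : Finset K} (hΓ : IsMulSubgroup Γ)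
    (hp : #Γ ^ 2 ≤ p) {f : K → ℝ} (hf0 : ∀ u, 0 ≤ f u) (hf : ∀ x ∈ Γ, ∀ u, f (x * u) = f u)
    (hs : 0 < ∑ u, f u) :
    ∑ v, convIndicator Γ f v ^ 2 ≤ 2 ^ 25 * (#Γ * (∑ u, f u) * √(∑ u, f u ^ 2)) := by
  set s := ∑ u, f u with hsdef
  set T := ∑ u, f u ^ 2 with hT
  have hTpos : 0 < T := by
    obtain ⟨u, -, hu⟩ := Finset.exists_ne_zero_of_sum_ne_zero hs.ne'
    exact Finset.sum_pos' (fun u _ => sq_nonneg _) ⟨u, Finset.mem_univ _, by positivity⟩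
  obtain ⟨q, hqpos, hq, hqT⟩ : ∃ q, 0 < q ∧ √T = q ∧ q * q = T :=
    ⟨√T, Real.sqrt_pos.2 hTpos, rfl, Real.mul_self_sqrt hTpos.le⟩
  have htail := sum_sq_filter_le_of_weak_type (convIndicator Γ f) (convIndicator_nonneg hf0)
      (by positivity) (convIndicator_weak_type (p := p) hΓ hp hf0 hf hs) hqpos
  have h1 : ∑ v, convIndicator Γ f v ^ 2 ≤
      q * (#Γ * s) + ∑ v with q ≤ convIndicator Γ f v, convIndicator Γ f v ^ 2 := by
    rw [← sum_univ_convIndicator, Finset.mul_sum, Finset.sum_filter, ← Finset.sum_add_distrib]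
    refine Finset.sum_le_sum fun v _ => ?_
    have := convIndicator_nonneg (Γ := Γ) hf0 v
    split_ifs with h
    · nlinarith
    · nlinarith
  rw [← hsdef, ← hT] at htail
  have h2 : 8 * (2 ^ 21 * #Γ * s * T) / q = 2 ^ 24 * (#Γ * s * q) := by
    rw [← hqT]; field_simp; norm_num
  have h3 : 0 ≤ #Γ * s * q := by positivity
  rw [h2] at htail
  rw [hq]
  nlinarith

/-- The number of representations of an element as a sum of `k` elements of `Γ`. -/
def repCount {K : Type*} [Field K] [Fintype K] [DecidableEq K] (Γ : Finset K) : ℕ → K → ℝ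
  | 0 => fun z => if z = 0 then 1 else 0
  | k + 1 => convIndicator Γ (repCount Γ k)

theorem repCount_nonneg {K : Type*} [Field K] [Fintype K] [DecidableEq K] (Γ : Finset K) (k : ℕ)
    (z : K) : 0 ≤ repCount Γ k z := by
  induction k generalizing z with
  | zero => simp only [repCount]; split_ifs <;> norm_num
  | succ k ih => exact convIndicator_nonneg ih z

theorem sum_repCount {K : Type*} [Field K] [Fintype K] [DecidableEq K] (Γ : Finset K) (k : ℕ) :
    ∑ z, repCount Γ k z = (#Γ : ℝ) ^ k := by
  induction k with
  | zero => simp [repCount]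
  | succ k ih => rw [repCount, sum_univ_convIndicator, ih, pow_succ']

theorem repCount_mul {K : Type*} [Field K] [Fintype K] [DecidableEq K] {Γ : Finset K}
    (hΓ : IsMulSubgroup Γ) (k : ℕ) (x : K) (hx : x ∈ Γ) (z : K) :
    repCount Γ k (x * z) = repCount Γ k z := by
  induction k generalizing x z with
  | zero => simp [repCount, hΓ.ne_zero hx]
  | succ k ih => exact convIndicator_mul hΓ (fun x hx u => ih x hx u) x hx z

theorem repCount_eq_card {K : Type*} [Field K] [Fintype K] [DecidableEq K] (Γ : Finset K) (k : ℕ)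
    (z : K) : repCount Γ k z = #{f : Fin k → K | (∀ i, f i ∈ Γ) ∧ ∑ i, f i = z} := by
  induction k generalizing z with
  | zero =>
    by_cases h : z = 0
    · simp [repCount, h]
    · simp [repCount, h, Ne.symm h]
  | succ k ih =>
    rw [repCount, convIndicator, Finset.sum_congr rfl fun u _ => ih u, ← Nat.cast_sum,
      ← Finset.card_sigma]
    congr 1
    refine Finset.card_bij' (fun a _ => Fin.cons (z - a.1) a.2)
      (fun f _ => ⟨z - f 0, Fin.tail f⟩) ?_ ?_ ?_ ?_
    · rintro ⟨u, f⟩ h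
      simp only [Finset.mem_sigma, Finset.mem_filter, Finset.mem_univ, true_and] at h
      simp [Fin.forall_fin_succ, Fin.sum_univ_succ, h.1, h.2.1, h.2.2]
    · intro f h
      simp only [Finset.mem_filter, Finset.mem_univ, true_and, Fin.forall_fin_succ,
        Fin.sum_univ_succ] at h
      simp only [Finset.mem_sigma, Finset.mem_filter, Finset.mem_univ, true_and, Fin.tail,
        sub_sub_cancel]
      exact ⟨h.1.1, h.1.2, by rw [← h.2]; ring⟩
    · rintro ⟨u, f⟩ h
      simp
    · intro f h
      simp

theorem Tk_eq_sum_repCount_sq {p : ℕ} [Fact p.Prime] (k : ℕ) (Γ : Finset (ZMod p)) :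
    (Tk k Γ : ℝ) = ∑ z, repCount Γ k z ^ 2 := by
  have h : ∀ z, repCount Γ k z ^ 2 = (#(({f : Fin k → ZMod p | (∀ i, f i ∈ Γ) ∧ ∑ i, f i = z} :
      Finset _) ×ˢ ({f : Fin k → ZMod p | (∀ i, f i ∈ Γ) ∧ ∑ i, f i = z} : Finset _)) : ℝ) := by
    intro z
    rw [repCount_eq_card, Finset.card_product, pow_two, Nat.cast_mul]
  rw [Finset.sum_congr rfl fun z _ => h z, ← Nat.cast_sum, ← Finset.card_sigma, Tk,
    Fintype.card_subtype]
  congr 1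
  refine Finset.card_bij' (fun q _ => ⟨∑ i, q.1 i, q⟩) (fun a _ => a.2) ?_ ?_ ?_ ?_
  · intro q hq
    simp only [Finset.mem_filter, Finset.mem_univ, true_and] at hq
    simp [hq.1, hq.2.1, hq.2.2]
  · rintro ⟨z, q⟩ hq
    simp only [Finset.mem_sigma, Finset.mem_product, Finset.mem_filter, Finset.mem_univ,
      true_and] at hq
    simp [hq.1.1, hq.2.1, hq.1.2, hq.2.2]
  · intro q hq
    rfl
  · rintro ⟨z, q⟩ hq
    simp only [Finset.mem_sigma, Finset.mem_product, Finset.mem_filter, Finset.mem_univ,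
      true_and] at hq
    obtain ⟨⟨-, rfl⟩, -⟩ := hq
    rfl

theorem sum_repCount_sq_le {K : Type*} [Field K] [Fintype K] [DecidableEq K] {p : ℕ}
    [CharP K p] {Γ : Finset K} (hΓ : IsMulSubgroup Γ)
    (hp : #Γ ^ 2 ≤ p) (k : ℕ) :
    ∑ z, repCount Γ k z ^ 2
      ≤ 2 ^ 50 * (#Γ : ℝ) ^ (2 * (k : ℝ) - 2 + (2 : ℝ) ^ (1 - (k : ℝ))) := by
  have ht : (0 : ℝ) < #Γ := by exact_mod_cast hΓ.card_pos
  induction k with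
  | zero => norm_num [repCount]
  | succ k ih =>
    have h1 := sum_sq_convIndicator_le (p := p) hΓ hp (repCount_nonneg Γ k)
      (repCount_mul hΓ k) (by rw [sum_repCount]; positivity)
    rw [sum_repCount] at h1
    refine h1.trans ?_
    set e : ℝ := 2 * (k : ℝ) - 2 + (2 : ℝ) ^ (1 - (k : ℝ)) with he
    have h2 : √(∑ z, repCount Γ k z ^ 2) ≤ 2 ^ 25 * (#Γ : ℝ) ^ (e / 2) := by
      refine Real.sqrt_le_iff.2 ⟨by positivity, ih.trans_eq ?_⟩
      rw [mul_pow, ← Real.rpow_mul_natCast ht.le]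
      norm_num
    have h3 : 2 * ((k + 1 : ℕ) : ℝ) - 2 + (2 : ℝ) ^ (1 - ((k + 1 : ℕ) : ℝ))
        = ((k + 1 : ℕ) : ℝ) + e / 2 := by
      have : (2 : ℝ) ^ (1 - (k : ℝ)) = 2 * (2 : ℝ) ^ (1 - ((k + 1 : ℕ) : ℝ)) := by
        rw [Nat.cast_add, Nat.cast_one, show 1 - ((k : ℝ) + 1) = -k by ring,
          Real.rpow_sub two_pos, Real.rpow_one,
          Real.rpow_neg zero_le_two, div_eq_mul_inv]
      rw [he, this]
      push_cast
      ring
    rw [h3, Real.rpow_add ht, Real.rpow_natCast]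
    calc (2 : ℝ) ^ 25 * (#Γ * #Γ ^ k * √(∑ z, repCount Γ k z ^ 2))
        ≤ 2 ^ 25 * (#Γ * #Γ ^ k * (2 ^ 25 * (#Γ : ℝ) ^ (e / 2))) := by gcongr
      _ = _ := by ring

/-- For every integer `d ≥ 2` there is a constant `C_d > 0` such that for every
prime `p` and every multiplicative subgroup `Γ ⊆ F_p^*` with `|Γ| < p^{1/2}`, one has
`T_d(Γ) ≤ C_d · |Γ|^{2d − 2 + 2^{1−d}}`. -/
theorem stmt7 :
    ∀ d : ℕ, 2 ≤ d →
      ∃ C : ℝ, 0 < C ∧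
        ∀ (p : ℕ) [Fact p.Prime], ∀ Γ : Finset (ZMod p),
          (0 : ZMod p) ∉ Γ → (1 : ZMod p) ∈ Γ →
          (∀ x ∈ Γ, ∀ y ∈ Γ, x * y ∈ Γ) → (∀ x ∈ Γ, x⁻¹ ∈ Γ) →
          (Γ.card : ℝ) < (p : ℝ) ^ ((1 : ℝ) / 2) →
          (Tk d Γ : ℝ) ≤
            C * (Γ.card : ℝ) ^ (2 * (d : ℝ) - 2 + (2 : ℝ) ^ (1 - (d : ℝ))) := by
  intro d _
  refine ⟨2 ^ 50, by positivity, fun p _ Γ h0 h1 hmul hinv hcard => ?_⟩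
  have hp : #Γ ^ 2 ≤ p := by
    rw [← Real.sqrt_eq_rpow, Real.lt_sqrt (Nat.cast_nonneg _)] at hcard
    exact_mod_cast hcard.le
  rw [Tk_eq_sum_repCount_sq]
  exact sum_repCount_sq_le (p := p) ⟨h0, h1, hmul, hinv⟩ hp d
end
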